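/- arXiv:2104.01886 — 2 statements merged into one kernel-verified Lean document; each statement's English description precedes it below -/
import Mathlib

section
/- As n → ∞, p_{1/2}(n) ~ 2^{5/18}·3^{−1/2}·π^{−1/2}·ζ(3)^{7/18}·e^{2ζ'(−1)+ζ'(0)}·n^{−8/9} · exp( (3ζ(3)^{1/3}/2^{1/3})·n^{2/3} + (ζ(2)/(2^{2/3}ζ(3)^{1/3}))·n^{1/3} − ζ(2)²/(24ζ(3)) ). -/
open Filter Topology Real

/-- The Piatetski-Shapiro part: `⌊ℓ^κ⌋`. -/
noncomputable def psPart (κ : ℝ) (ℓ : ℕ) : ℕ := ⌊(ℓ : ℝ) ^ κ⌋₊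

/-- `p_κ(n)`: number of partitions of `n` into parts from `(⌊ℓ^κ⌋)_{ℓ ≥ 1}`. -/
noncomputable def pk (κ : ℝ) (n : ℕ) : ℕ :=
  Nat.card {r : ℕ →₀ ℕ // (r.sum fun ℓ j => j * psPart κ (ℓ + 1)) = n}

/-- Riemann zeta at a real argument (real-valued there). -/
noncomputable def realZeta (x : ℝ) : ℝ := (riemannZeta (x : ℂ)).re

/-- Derivative of the Riemann zeta function at a real argument (real-valued there). -/
noncomputable def realZetaDeriv (x : ℝ) : ℝ := (deriv riemannZeta (x : ℂ)).re

namespace SqrtPartition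

lemma psPart_half (n : ℕ) : psPart (1 / 2) n = Nat.sqrt n := by
  rw [psPart, ← Real.sqrt_eq_rpow, Real.nat_floor_real_sqrt_eq_nat_sqrt]

/-- The closed form of `∑ k ≥ 1, (2 * k + 1) * z ^ k`. -/
noncomputable def oddGen (z : ℂ) : ℂ := 2 * z / (1 - z) ^ 2 + z / (1 - z)

lemma one_sub_ne_zero {z : ℂ} (hz : ‖z‖ < 1) : 1 - z ≠ 0 := by
  intro h
  rw [← sub_eq_zero.mp h] at hz
  simp at hz

lemma hasSum_odd_mul_pow {z : ℂ} (hz : ‖z‖ < 1) :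
    HasSum (fun k : ℕ => (2 * k + 3 : ℂ) * z ^ (k + 1)) (oddGen z) := by
  have h1 := one_sub_ne_zero hz
  have h := (((hasSum_coe_mul_geometric_of_norm_lt_one hz).mul_left 2).add
    ((hasSum_geometric_of_norm_lt_one hz).mul_left 3)).mul_left z
  convert! h using 1
  · funext k
    ring
  · rw [oddGen]
    field_simp
    ring

lemma sum_range_sqrt {R : Type*} [CommSemiring R] (f : ℕ → R) (K : ℕ) :
    ∑ l ∈ Finset.range (K * (K + 2)), f (Nat.sqrt (l + 1)) =
      ∑ k ∈ Finset.range K, (2 * k + 3 : R) * f (k + 1) := by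
  induction K with
  | zero => simp
  | succ K ih =>
    have e : (K + 1) * (K + 1 + 2) = K * (K + 2) + (2 * K + 3) := by ring
    rw [e, Finset.sum_range_add, ih, Finset.sum_range_succ _ K]
    congr 1
    rw [Finset.sum_congr rfl (g := fun _ => f (K + 1)) ?_]
    · simp
    · intro x hx
      have hx' := Finset.mem_range.mp hx
      have : K * (K + 2) + x + 1 = (K + 1) * (K + 1) + x := by ring
      rw [this, Nat.sqrt_add_eq (K + 1) (by omega)]

lemma sqrt_succ_pos (l : ℕ) : 1 ≤ Nat.sqrt (l + 1) :=
  Nat.sqrt_pos.mpr (Nat.succ_pos l)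

lemma summable_pow_sqrt {r : ℝ} (h0 : 0 ≤ r) (h1 : r < 1) :
    Summable (fun l : ℕ => r ^ Nat.sqrt (l + 1)) := by
  have hz : ‖(r : ℂ)‖ < 1 := by simpa [abs_of_nonneg h0] using h1
  have hs : Summable (fun k : ℕ => (2 * k + 3 : ℝ) * r ^ (k + 1)) := by
    have := (hasSum_odd_mul_pow hz).summable
    exact_mod_cast this
  refine summable_of_sum_range_le (c := ∑' k : ℕ, (2 * k + 3 : ℝ) * r ^ (k + 1))
    (fun l => by positivity) (fun n => ?_)
  calc ∑ l ∈ Finset.range n, r ^ Nat.sqrt (l + 1)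
      ≤ ∑ l ∈ Finset.range (n * (n + 2)), r ^ Nat.sqrt (l + 1) := by
        refine Finset.sum_le_sum_of_subset_of_nonneg ?_ (fun _ _ _ => by positivity)
        exact Finset.range_mono (by nlinarith)
    _ = ∑ k ∈ Finset.range n, (2 * k + 3 : ℝ) * r ^ (k + 1) := sum_range_sqrt _ n
    _ ≤ _ := hs.sum_le_tsum _ (fun _ _ => by positivity)

lemma hasSum_pow_sqrt {z : ℂ} (hz : ‖z‖ < 1) :
    HasSum (fun l : ℕ => z ^ Nat.sqrt (l + 1)) (oddGen z) := by
  have hs : Summable (fun l : ℕ => z ^ Nat.sqrt (l + 1)) := by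
    refine Summable.of_norm ?_
    simpa using summable_pow_sqrt (norm_nonneg z) hz
  have ht : Tendsto (fun K : ℕ => K * (K + 2)) atTop atTop :=
    tendsto_atTop_mono (fun K => show K ≤ _ by nlinarith) tendsto_id
  have h1 := hs.hasSum.tendsto_sum_nat.comp ht
  have h2 := (hasSum_odd_mul_pow hz).tendsto_sum_nat
  have : ∑' l : ℕ, z ^ Nat.sqrt (l + 1) = oddGen z := by
    refine tendsto_nhds_unique h1 (h2.congr (fun K => ?_))
    exact (sum_range_sqrt (fun s => z ^ s) K).symm
  exact this ▸ hs.hasSum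

lemma norm_oddGen_le {z : ℂ} {r : ℝ} (hz : ‖z‖ ≤ r) (hr : r < 1) :
    ‖oddGen z‖ ≤ (oddGen r).re := by
  have h0 : 0 ≤ r := (norm_nonneg z).trans hz
  have hr' : ‖(r : ℂ)‖ < 1 := by simpa [abs_of_nonneg h0] using hr
  have h1 := Complex.hasSum_re (hasSum_pow_sqrt hr')
  have h1' : HasSum (fun l : ℕ => r ^ Nat.sqrt (l + 1)) (oddGen r).re := by
    refine h1.congr_fun ?_
    intro l
    simp [← Complex.ofReal_pow]
  rw [← (hasSum_pow_sqrt (hz.trans_lt hr)).tsum_eq]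
  refine tsum_of_norm_bounded h1' (fun l => ?_)
  rw [norm_pow]
  gcongr

/-- The generating series of partitions into the parts `⌊√1⌋, …, ⌊√L⌋`. -/
noncomputable def truncSeries (L : ℕ) : PowerSeries ℕ :=
  ∏ l ∈ Finset.range L, PowerSeries.mk fun m => if Nat.sqrt (l + 1) ∣ m then 1 else 0

/-- The number of partitions of `n` into the parts `⌊√1⌋, …, ⌊√L⌋`. -/
noncomputable def truncCount (L n : ℕ) : ℕ := PowerSeries.coeff n (truncSeries L)

lemma truncCount_eq_card (L n : ℕ) :
    truncCount L n = ((Finset.finsuppAntidiag (Finset.range L) n).filter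
      fun f => ∀ l ∈ Finset.range L, Nat.sqrt (l + 1) ∣ f l).card := by
  classical
  rw [truncCount, truncSeries, PowerSeries.coeff_prod, Finset.card_filter]
  refine Finset.sum_congr rfl (fun f _ => ?_)
  simp only [PowerSeries.coeff_mk]
  rw [Finset.prod_boole]

lemma truncSeries_succ (L : ℕ) : truncSeries (L + 1) =
    truncSeries L * PowerSeries.mk fun m => if Nat.sqrt (L + 1) ∣ m then 1 else 0 := by
  rw [truncSeries, Finset.prod_range_succ, truncSeries]

lemma truncCount_mono (n : ℕ) : Monotone fun L => truncCount L n := by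
  refine monotone_nat_of_le_succ (fun L => ?_)
  simp only [truncCount, truncSeries_succ, PowerSeries.coeff_mul, PowerSeries.coeff_mk]
  have h : (n, 0) ∈ Finset.HasAntidiagonal.antidiagonal n := by simp
  refine le_trans ?_ (Finset.single_le_sum (fun _ _ => Nat.zero_le _) h)
  simp

lemma truncCount_eq_pk {L n : ℕ} (h : (n + 1) ^ 2 ≤ L) :
    truncCount L n = pk (1 / 2) n := by
  rw [truncCount_eq_card]
  simp only [pk, psPart_half]
  refine (Nat.subtype_card (p := fun f : ℕ →₀ ℕ => f ∈ _) _ fun _ => Iff.rfl).symm.trans ?_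
  have hw : ∀ r : ℕ →₀ ℕ, r.support ⊆ Finset.range L →
      (r.sum fun l j => j * Nat.sqrt (l + 1)) = ∑ l ∈ Finset.range L, r l * Nat.sqrt (l + 1) :=
    fun r hr => Finsupp.sum_of_support_subset _ hr _ (by simp)
  have hsupp : ∀ r : ℕ →₀ ℕ, (r.sum fun l j => j * Nat.sqrt (l + 1)) = n →
      r.support ⊆ Finset.range L := by
    intro r hr l hl
    have h1 : r l * Nat.sqrt (l + 1) ≤ n := by
      rw [← hr]
      exact Finset.single_le_sum (f := fun l => r l * Nat.sqrt (l + 1))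
        (fun _ _ => Nat.zero_le _) hl
    have h2 : Nat.sqrt (l + 1) ≤ n :=
      (Nat.le_mul_of_pos_left _ (Nat.pos_of_ne_zero (Finsupp.mem_support_iff.mp hl))).trans h1
    have h3 : l + 1 < (n + 1) * (n + 1) := Nat.sqrt_lt.mp (Nat.lt_succ_of_le h2)
    rw [Finset.mem_range]
    nlinarith
  refine Nat.card_congr
    { toFun := fun f => ⟨Finsupp.onFinset f.1.support (fun l => f.1 l / Nat.sqrt (l + 1))
        (fun l hl => by
          rw [Finsupp.mem_support_iff]
          intro h0
          simp [h0] at hl), ?_⟩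
      invFun := fun r => ⟨Finsupp.onFinset r.1.support (fun l => r.1 l * Nat.sqrt (l + 1))
        (fun l hl => by
          rw [Finsupp.mem_support_iff]
          intro h0
          simp [h0] at hl), ?_⟩
      left_inv := ?_
      right_inv := ?_ }
  · obtain ⟨f, hf⟩ := f
    obtain ⟨hf1, hf2⟩ := Finset.mem_filter.mp hf
    obtain ⟨hf3, hf4⟩ := Finset.mem_finsuppAntidiag.mp hf1
    rw [hw _ (Finsupp.support_onFinset_subset.trans hf4)]
    refine Eq.trans ?_ hf3
    refine Finset.sum_congr rfl (fun l hl => ?_)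
    exact Nat.div_mul_cancel (hf2 l hl)
  · obtain ⟨r, hr⟩ := r
    have hs := hsupp r hr
    refine Finset.mem_filter.mpr ⟨Finset.mem_finsuppAntidiag.mpr
      ⟨?_, Finsupp.support_onFinset_subset.trans hs⟩, fun l _ => ?_⟩
    · exact (hw r hs).symm.trans hr
    · exact Dvd.intro_left _ rfl
  · rintro ⟨f, hf⟩
    obtain ⟨hf1, hf2⟩ := Finset.mem_filter.mp hf
    obtain ⟨hf3, hf4⟩ := Finset.mem_finsuppAntidiag.mp hf1
    ext l
    by_cases hl : l ∈ Finset.range L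
    · exact Nat.div_mul_cancel (hf2 l hl)
    · have : f l = 0 := by
        by_contra h0
        exact hl (hf4 (Finsupp.mem_support_iff.mpr h0))
      simp [this]
  · rintro ⟨r, hr⟩
    ext l
    exact Nat.mul_div_cancel _ (sqrt_succ_pos l)

lemma hasSum_dvd_pow {s : ℕ} (hs : 1 ≤ s) {z : ℂ} (hz : ‖z‖ < 1) :
    HasSum (fun n : ℕ => (((if s ∣ n then 1 else 0 : ℕ) : ℂ)) * z ^ n) (1 - z ^ s)⁻¹ := by
  have hi : Function.Injective fun j : ℕ => s * j :=
    fun a b h => Nat.eq_of_mul_eq_mul_left hs h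
  rw [← hi.hasSum_iff]
  · have hzs : ‖z ^ s‖ < 1 := by
      rw [norm_pow]
      exact pow_lt_one₀ (norm_nonneg z) hz (by omega)
    refine (hasSum_geometric_of_norm_lt_one hzs).congr_fun (fun j => ?_)
    simp [pow_mul]
  · intro n hn
    have : ¬ s ∣ n := fun ⟨j, hj⟩ => hn ⟨j, hj.symm⟩
    simp [this]

lemma summable_norm_dvd_pow (s : ℕ) {z : ℂ} (hz : ‖z‖ < 1) :
    Summable (fun n : ℕ => ‖(((if s ∣ n then 1 else 0 : ℕ) : ℂ)) * z ^ n‖) := by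
  refine Summable.of_nonneg_of_le (fun _ => norm_nonneg _) (fun n => ?_)
    (summable_geometric_of_lt_one (norm_nonneg z) hz)
  rw [norm_mul, norm_pow]
  split_ifs <;> simp

lemma truncCount_eval (L : ℕ) {z : ℂ} (hz : ‖z‖ < 1) :
    Summable (fun n : ℕ => ‖(truncCount L n : ℂ) * z ^ n‖) ∧
    ∑' n : ℕ, (truncCount L n : ℂ) * z ^ n =
      ∏ l ∈ Finset.range L, (1 - z ^ Nat.sqrt (l + 1))⁻¹ := by
  induction L with
  | zero =>
    have h : ∀ n : ℕ, n ≠ 0 → (truncCount 0 n : ℂ) * z ^ n = 0 := by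
      intro n hn
      simp [truncCount, truncSeries, PowerSeries.coeff_one, hn]
    refine ⟨summable_of_ne_finset_zero (s := {0}) (fun n hn => ?_), ?_⟩
    · rw [h n (by simpa using hn), norm_zero]
    · rw [tsum_eq_single 0 h]
      simp [truncCount, truncSeries]
  | succ L ih =>
    have hd := summable_norm_dvd_pow (Nat.sqrt (L + 1)) hz
    have e : ∀ n : ℕ, (truncCount (L + 1) n : ℂ) * z ^ n =
        ∑ kl ∈ Finset.HasAntidiagonal.antidiagonal n,
          ((truncCount L kl.1 : ℂ) * z ^ kl.1) *
          ((((if Nat.sqrt (L + 1) ∣ kl.2 then 1 else 0 : ℕ) : ℂ)) * z ^ kl.2) := by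
      intro n
      rw [truncCount, truncSeries_succ, PowerSeries.coeff_mul, Nat.cast_sum, Finset.sum_mul]
      refine Finset.sum_congr rfl (fun kl hkl => ?_)
      rw [← Finset.HasAntidiagonal.mem_antidiagonal.mp hkl, pow_add, PowerSeries.coeff_mk,
        Nat.cast_mul, truncCount]
      ring
    refine ⟨(summable_norm_sum_mul_antidiagonal_of_summable_norm ih.1 hd).congr
      (fun n => congrArg norm (e n).symm), ?_⟩
    rw [tsum_congr e, ← tsum_mul_tsum_eq_tsum_sum_antidiagonal_of_summable_norm ih.1 hd, ih.2,
      (hasSum_dvd_pow (sqrt_succ_pos L) hz).tsum_eq, Finset.prod_range_succ]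

/-- The logarithm of the generating function, `∑ m ≥ 1, (∑ l, z ^ (m ⌊√l⌋)) / m`. -/
noncomputable def logGen (z : ℂ) : ℂ := ∑' m : ℕ, oddGen (z ^ (m + 1)) / (m + 1)

lemma norm_pow_succ_lt {z : ℂ} (hz : ‖z‖ < 1) (m : ℕ) : ‖z ^ (m + 1)‖ < 1 := by
  rw [norm_pow]
  exact pow_lt_one₀ (norm_nonneg z) hz (by omega)

lemma summable_logGen_double {z : ℂ} (hz : ‖z‖ < 1) :
    Summable (fun p : ℕ × ℕ => (z ^ (p.2 + 1)) ^ Nat.sqrt (p.1 + 1) / (p.2 + 1 : ℂ)) := by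
  have hr := norm_nonneg z
  have h := Summable.mul_of_nonneg (summable_pow_sqrt hr hz) (summable_geometric_of_lt_one hr hz)
    (fun _ => by positivity) (fun _ => by positivity)
  refine Summable.of_norm_bounded h (fun p => ?_)
  have hs := sqrt_succ_pos p.1
  have hm : ‖(p.2 + 1 : ℂ)‖ = p.2 + 1 := by
    rw [← Nat.cast_add_one, Complex.norm_natCast, Nat.cast_add_one]
  rw [norm_div, norm_pow, norm_pow, ← pow_mul, ← pow_add, hm]
  refine (div_le_self (by positivity) (by linarith [Nat.cast_nonneg (α := ℝ) p.2])).trans ?_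
  refine pow_le_pow_of_le_one hr hz.le ?_
  nlinarith

lemma hasSum_logGen {z : ℂ} (hz : ‖z‖ < 1) :
    HasSum (fun m : ℕ => oddGen (z ^ (m + 1)) / (m + 1)) (logGen z) := by
  have h := (summable_logGen_double hz).prod_symm.prod
  refine Summable.hasSum (h.congr (fun m => ?_))
  exact ((hasSum_pow_sqrt (norm_pow_succ_lt hz m)).div_const (m + 1 : ℂ)).tsum_eq

lemma hasSum_neg_log {z : ℂ} (hz : ‖z‖ < 1) :
    HasSum (fun l : ℕ => -Complex.log (1 - z ^ Nat.sqrt (l + 1))) (logGen z) := by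
  have hd := summable_logGen_double hz
  have e1 : ∀ l : ℕ, HasSum (fun m : ℕ => (z ^ (m + 1)) ^ Nat.sqrt (l + 1) / (m + 1 : ℂ))
      (-Complex.log (1 - z ^ Nat.sqrt (l + 1))) := by
    intro l
    have hzs : ‖z ^ Nat.sqrt (l + 1)‖ < 1 := by
      rw [norm_pow]
      exact pow_lt_one₀ (norm_nonneg z) hz (Nat.one_le_iff_ne_zero.mp (sqrt_succ_pos l))
    have := (hasSum_nat_add_iff' 1).mpr (Complex.hasSum_taylorSeries_neg_log hzs)
    refine HasSum.congr_fun (by simpa using this) (fun m => ?_)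
    rw [← pow_mul, ← pow_mul, mul_comm]
  have h2 := hd.tsum_comm' (fun l => (e1 l).summable)
    (fun m => ((hasSum_pow_sqrt (norm_pow_succ_lt hz m)).div_const _).summable)
  have h3 := hd.prod.hasSum
  simp only [(e1 _).tsum_eq] at h3 h2
  rw [← h2] at h3
  convert! h3 using 1
  exact tsum_congr fun m =>
    ((hasSum_pow_sqrt (norm_pow_succ_lt hz m)).div_const (m + 1 : ℂ)).tsum_eq.symm

lemma tendsto_prod_inv {z : ℂ} (hz : ‖z‖ < 1) :
    Tendsto (fun L : ℕ => ∏ l ∈ Finset.range L, (1 - z ^ Nat.sqrt (l + 1))⁻¹) atTop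
      (𝓝 (Complex.exp (logGen z))) := by
  refine ((Complex.continuous_exp.tendsto _).comp (hasSum_neg_log hz).tendsto_sum_nat).congr
    (fun L => ?_)
  rw [Function.comp, Complex.exp_sum]
  refine Finset.prod_congr rfl (fun l _ => ?_)
  have hzs : ‖z ^ Nat.sqrt (l + 1)‖ < 1 := by
    rw [norm_pow]
    exact pow_lt_one₀ (norm_nonneg z) hz (Nat.one_le_iff_ne_zero.mp (sqrt_succ_pos l))
  rw [Complex.exp_neg, Complex.exp_log (one_sub_ne_zero hzs)]

lemma tendsto_truncCount (n : ℕ) :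
    Tendsto (fun L => truncCount L n) atTop (𝓝 (pk (1 / 2) n)) :=
  tendsto_atTop_of_eventually_const (i₀ := (n + 1) ^ 2) fun _ h => truncCount_eq_pk h

lemma truncCount_le_pk (L n : ℕ) : truncCount L n ≤ pk (1 / 2) n := by
  rw [← truncCount_eq_pk (le_max_left ((n + 1) ^ 2) L)]
  exact truncCount_mono n (le_max_right _ _)

lemma summable_pk {r : ℝ} (h0 : 0 ≤ r) (h1 : r < 1) :
    Summable (fun n : ℕ => (pk (1 / 2) n : ℝ) * r ^ n) := by
  have hz : ‖(r : ℂ)‖ < 1 := by simpa [abs_of_nonneg h0] using h1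
  obtain ⟨B, hB⟩ := (tendsto_prod_inv hz).norm.bddAbove_range
  refine summable_of_sum_range_le (c := B) (fun n => by positivity) (fun N => ?_)
  refine le_trans ?_ (hB ⟨(N + 1) ^ 2, rfl⟩)
  have h := truncCount_eval ((N + 1) ^ 2) hz
  have e : ∀ n, ‖((truncCount ((N + 1) ^ 2) n : ℕ) : ℂ) * (r : ℂ) ^ n‖ =
      (truncCount ((N + 1) ^ 2) n : ℝ) * r ^ n := by
    intro n
    simp [abs_of_nonneg h0]
  have hs : Summable fun n => (truncCount ((N + 1) ^ 2) n : ℝ) * r ^ n := by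
    simpa only [e] using h.1
  have hn : ‖∏ l ∈ Finset.range ((N + 1) ^ 2), (1 - (r : ℂ) ^ Nat.sqrt (l + 1))⁻¹‖ =
      ∑' n, (truncCount ((N + 1) ^ 2) n : ℝ) * r ^ n := by
    rw [← h.2]
    have : (∑' n, ((truncCount ((N + 1) ^ 2) n : ℕ) : ℂ) * (r : ℂ) ^ n) =
        ((∑' n, (truncCount ((N + 1) ^ 2) n : ℝ) * r ^ n : ℝ) : ℂ) := by
      push_cast
      rfl
    rw [this, Complex.norm_real, Real.norm_of_nonneg (tsum_nonneg fun n => by positivity)]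
  simp only [hn]
  refine le_trans (le_of_eq ?_) (hs.sum_le_tsum (Finset.range N) (fun _ _ => by positivity))
  refine Finset.sum_congr rfl (fun n hn => ?_)
  rw [truncCount_eq_pk]
  have := Finset.mem_range.mp hn
  gcongr

theorem hasSum_pk {z : ℂ} (hz : ‖z‖ < 1) :
    HasSum (fun n : ℕ => (pk (1 / 2) n : ℂ) * z ^ n) (Complex.exp (logGen z)) := by
  have hs := summable_pk (norm_nonneg z) hz
  have hs' : Summable (fun n : ℕ => (pk (1 / 2) n : ℂ) * z ^ n) := by
    refine Summable.of_norm ?_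
    simpa using hs
  have h := tendsto_tsum_of_dominated_convergence (𝓕 := atTop) hs
    (f := fun L n => (truncCount L n : ℂ) * z ^ n)
    (g := fun n => (pk (1 / 2) n : ℂ) * z ^ n)
    (fun n => Tendsto.mul_const _ ((continuous_of_discreteTopology.tendsto _).comp
      (tendsto_truncCount n)))
    (Eventually.of_forall fun L n => by
      rw [norm_mul, norm_pow, Complex.norm_natCast]
      gcongr
      exact truncCount_le_pk L n)
  simp only [(truncCount_eval _ hz).2] at h
  exact (tendsto_nhds_unique h (tendsto_prod_inv hz)) ▸ hs'.hasSum

lemma norm_oddGen_le_div {z : ℂ} (hz : ‖z‖ < 1) : ‖oddGen z‖ ≤ 3 * ‖z‖ / (1 - ‖z‖) ^ 2 := by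
  have h0 := norm_nonneg z
  have h1 : 0 < 1 - ‖z‖ := by linarith
  have h2 : 1 - ‖z‖ ≤ ‖1 - z‖ := by simpa using norm_sub_norm_le (1 : ℂ) z
  calc ‖oddGen z‖ ≤ 2 * ‖z‖ / ‖1 - z‖ ^ 2 + ‖z‖ / ‖1 - z‖ := by
        refine (norm_add_le _ _).trans (le_of_eq ?_)
        simp
    _ ≤ 2 * ‖z‖ / (1 - ‖z‖) ^ 2 + ‖z‖ / (1 - ‖z‖) := by gcongr
    _ ≤ 2 * ‖z‖ / (1 - ‖z‖) ^ 2 + ‖z‖ / (1 - ‖z‖) ^ 2 := by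
        gcongr
        nlinarith
    _ = _ := by ring

lemma norm_exp_neg_lt {u : ℂ} (hu : 0 < u.re) : ‖Complex.exp (-u)‖ < 1 := by
  rw [Complex.norm_exp]
  simpa using hu

lemma exp_neg_div_le {x : ℝ} (hx : 0 < x) :
    Real.exp (-x) / (1 - Real.exp (-x)) ^ 2 ≤ (1 + x) / x ^ 2 := by
  have h1 : x + 1 ≤ Real.exp x := Real.add_one_le_exp x
  have h2 : Real.exp (-x) / (1 - Real.exp (-x)) ^ 2 = Real.exp x / (Real.exp x - 1) ^ 2 := by
    rw [Real.exp_neg]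
    have : Real.exp x ≠ 0 := (Real.exp_pos x).ne'
    have h3 : Real.exp x - 1 ≠ 0 := by linarith
    have h4 : 1 - (Real.exp x)⁻¹ ≠ 0 := by
      rw [← Real.exp_neg]
      have : Real.exp (-x) < 1 := by simpa using hx
      linarith
    field_simp
  rw [h2, div_le_div_iff₀ (by nlinarith) (by positivity)]
  nlinarith [mul_nonneg (by linarith : (0 : ℝ) ≤ Real.exp x - (x + 1))
    (by nlinarith : (0 : ℝ) ≤ (1 + x) * (Real.exp x - 1) - x)]

lemma norm_oddGen_exp_le {u : ℂ} (hu : 0 < u.re) :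
    ‖oddGen (Complex.exp (-u))‖ ≤ 3 * ((1 + u.re) / u.re ^ 2) := by
  refine (norm_oddGen_le_div (norm_exp_neg_lt hu)).trans ?_
  rw [Complex.norm_exp, Complex.neg_re, mul_div_assoc]
  exact mul_le_mul_of_nonneg_left (exp_neg_div_le hu) (by norm_num)

/-- The part of `oddGen (exp (-u))` which stays bounded as `u → 0`. -/
noncomputable def oddRem (u : ℂ) : ℂ := oddGen (Complex.exp (-u)) - 2 / u ^ 2 - 1 / u

/-- The regularised kernel whose integral is the constant term of the logarithm of the
generating function. -/
noncomputable def rho (u : ℂ) : ℂ := (oddRem u + 2 / 3 * Complex.exp (-u)) / u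

lemma one_sub_exp_neg_ne_zero {u : ℂ} (hu : 0 < u.re) : 1 - Complex.exp (-u) ≠ 0 :=
  one_sub_ne_zero (norm_exp_neg_lt hu)

lemma ne_zero_of_re_pos {u : ℂ} (hu : 0 < u.re) : u ≠ 0 := by
  rintro rfl
  simp at hu

lemma continuousAt_oddGen_exp {u : ℂ} (hu : 0 < u.re) :
    ContinuousAt (fun u => oddGen (Complex.exp (-u))) u := by
  have h1 := one_sub_exp_neg_ne_zero hu
  unfold oddGen
  fun_prop (disch := simpa using h1)

lemma continuousAt_rho {u : ℂ} (hu : 0 < u.re) : ContinuousAt rho u := by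
  have h0 := ne_zero_of_re_pos hu
  have h1 := continuousAt_oddGen_exp hu
  unfold rho oddRem
  fun_prop (disch := simpa using h0)

lemma rho_bound_near : ∃ C : ℝ, ∀ u : ℂ, u ≠ 0 → ‖u‖ ≤ 1 / 2 → ‖rho u‖ ≤ C := by
  let p : ℂ × ℂ → ℂ := fun v => 1 + v.1 / 2 + v.1 ^ 2 / 6 + v.1 ^ 3 * v.2
  let Q : ℂ × ℂ → ℂ := fun v =>
    3 * (1 / 6 + v.1 * v.2)
      - 2 * ((1 / 6 + 2 * v.2) + v.1 * (1 / 36 + v.2) + v.1 ^ 2 * (v.2 / 3) + v.1 ^ 3 * v.2 ^ 2)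
      - ((1 / 4 + 1 / 3) + v.1 * (1 / 6 + 2 * v.2) + v.1 ^ 2 * (1 / 36 + v.2) + v.1 ^ 3 * (v.2 / 3)
        + v.1 ^ 4 * v.2 ^ 2)
      + 2 / 3 * (1 + v.1 * (1 / 4 + 1 / 3) + v.1 ^ 2 * (1 / 6 + 2 * v.2)
        + v.1 ^ 3 * (1 / 36 + v.2) + v.1 ^ 4 * (v.2 / 3) + v.1 ^ 5 * v.2 ^ 2)
  have hQ : Continuous Q := by fun_prop
  obtain ⟨B, hB⟩ := ((isCompact_closedBall (0 : ℂ × ℂ) 1).exists_bound_of_continuousOn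
    hQ.continuousOn)
  refine ⟨B * 4 + 4, fun u hu hu2 => ?_⟩
  let η : ℂ := (Complex.exp u - (1 + u + u ^ 2 / 2 + u ^ 3 / 6)) / u ^ 4
  have hE : Complex.exp u = 1 + u * p (u, η) := by
    simp only [p, η]
    field_simp
    ring
  have hη : ‖η‖ ≤ 1 := by
    have h := Complex.exp_bound (x := u) (by linarith) (n := 4) (by norm_num)
    simp only [Finset.sum_range_succ, Finset.sum_range_zero, Nat.factorial] at h
    norm_num at h
    rw [norm_div, norm_pow, div_le_one (by positivity)]
    refine h.trans ?_
    have : (0 : ℝ) < ‖u‖ ^ 4 := by positivity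
    linarith
  have hm : (u, η) ∈ Metric.closedBall (0 : ℂ × ℂ) 1 := by
    rw [mem_closedBall_zero_iff, Prod.norm_def]
    exact max_le (by linarith) hη
  have hp : 1 / 2 ≤ ‖p (u, η)‖ := by
    have h := Complex.norm_exp_sub_one_sub_id_le (x := u) (by linarith)
    have h3 : Complex.exp u - 1 - u = u * (p (u, η) - 1) := by rw [hE]; ring
    rw [h3, norm_mul, sq] at h
    have h4 : ‖p (u, η) - 1‖ ≤ ‖u‖ := le_of_mul_le_mul_left h (norm_pos_iff.mpr hu)
    have h5 := norm_sub_norm_le (1 : ℂ) (1 - p (u, η))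
    rw [norm_sub_rev] at h4
    simp only [norm_one, sub_sub_cancel] at h5
    linarith
  have hp0 : p (u, η) ≠ 0 := by
    intro h
    rw [h, norm_zero] at hp
    linarith
  have hE0 := Complex.exp_ne_zero u
  have key : rho u = Q (u, η) / p (u, η) ^ 2 + 2 / 3 * ((Complex.exp (-u) - 1) / u) := by
    have e1 : oddGen (Complex.exp (-u)) = (3 * Complex.exp u - 1) / (Complex.exp u - 1) ^ 2 := by
      have h1 : Complex.exp u - 1 ≠ 0 := by
        rw [hE]
        simpa using ⟨hu, hp0⟩
      have h2 : 1 - (Complex.exp u)⁻¹ ≠ 0 := by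
        intro h
        apply h1
        field_simp at h
        simpa using h
      rw [oddGen, Complex.exp_neg]
      field_simp
      ring
    have e2 : (3 * Complex.exp u - 1) / (Complex.exp u - 1) ^ 2 - 2 / u ^ 2 - 1 / u + 2 / 3 =
        u * (Q (u, η) / p (u, η) ^ 2) := by
      rw [hE]
      have h6 : u ^ 3 * Q (u, η) = 2 + 3 * (u * p (u, η)) - (2 + u) * p (u, η) ^ 2
          + 2 / 3 * u ^ 2 * p (u, η) ^ 2 := by
        simp only [Q, p]
        ring
      have h7 : u * p (u, η) ≠ 0 := mul_ne_zero hu hp0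
      have h8 : (1 + u * p (u, η) - 1) = u * p (u, η) := by ring
      rw [h8]
      generalize p (u, η) = P at *
      generalize Q (u, η) = R at *
      field_simp
      linear_combination -3 * h6
    rw [rho, oddRem, e1]
    field_simp at e2 ⊢
    linear_combination e2
  have hexp : ‖(Complex.exp (-u) - 1) / u‖ ≤ 2 := by
    rw [norm_div, div_le_iff₀ (norm_pos_iff.mpr hu)]
    simpa using Complex.norm_exp_sub_one_le (x := -u) (by rw [norm_neg]; linarith)
  have hB0 := hB _ hm
  rw [key]
  refine (norm_add_le _ _).trans (add_le_add ?_ ?_)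
  · rw [norm_div, norm_pow, div_le_iff₀ (by positivity)]
    have : 0 ≤ B := (norm_nonneg _).trans hB0
    have h4 : 1 ≤ 4 * ‖p (u, η)‖ ^ 2 := by nlinarith
    nlinarith
  · rw [norm_mul]
    have : ‖(2 / 3 : ℂ)‖ = 2 / 3 := by norm_num
    rw [this]
    linarith

lemma rho_bound : ∃ C : ℝ, 0 < C ∧ ∀ u : ℂ, 0 < u.re → |u.im| ≤ u.re →
    ‖rho u‖ ≤ C / (1 + ‖u‖ ^ 2) := by
  obtain ⟨C, hC⟩ := rho_bound_near
  refine ⟨max (2 * C) 185, lt_max_of_lt_right (by norm_num), fun u hu him => ?_⟩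
  have h0 := ne_zero_of_re_pos hu
  have hn : 0 < ‖u‖ := norm_pos_iff.mpr h0
  rw [le_div_iff₀ (by positivity)]
  rcases le_total ‖u‖ (1 / 2) with h | h
  · have h1 := hC u h0 h
    have h2 : 0 ≤ ‖rho u‖ := norm_nonneg _
    refine le_trans ?_ (le_max_left _ _)
    have h3 : ‖u‖ ^ 2 ≤ 1 := by nlinarith
    nlinarith
  · refine le_trans ?_ (le_max_right _ _)
    have hx : ‖u‖ ≤ 2 * u.re := by
      have := Complex.norm_le_abs_re_add_abs_im u
      rw [abs_of_pos hu] at this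
      linarith
    have hx2 : 1 / u.re ≤ 2 / ‖u‖ := by
      rw [div_le_div_iff₀ hu hn]
      linarith
    have h1 : ‖oddGen (Complex.exp (-u))‖ ≤ 30 / ‖u‖ := by
      refine (norm_oddGen_exp_le hu).trans ?_
      have : (1 + u.re) / u.re ^ 2 ≤ 5 * (1 / u.re) := by
        rw [mul_one_div, div_le_div_iff₀ (by positivity) hu]
        nlinarith
      have e : 30 / ‖u‖ = 3 * (5 * (2 / ‖u‖)) := by ring
      rw [e]
      linarith
    have h2 : ‖Complex.exp (-u)‖ ≤ 2 / ‖u‖ := by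
      refine le_trans ?_ hx2
      rw [Complex.norm_exp, Complex.neg_re, Real.exp_neg, ← one_div]
      exact one_div_le_one_div_of_le hu (by linarith [Real.add_one_le_exp u.re])
    have h3 : ‖(2 : ℂ) / u ^ 2‖ ≤ 4 / ‖u‖ := by
      rw [norm_div, norm_pow, Complex.norm_ofNat, div_le_div_iff₀ (by positivity) hn]
      nlinarith
    have h4 : ‖rho u‖ ≤ 37 / ‖u‖ / ‖u‖ := by
      rw [rho, oddRem, norm_div]
      gcongr
      refine (norm_add_le _ _).trans ?_
      have a1 := norm_sub_le (oddGen (Complex.exp (-u)) - 2 / u ^ 2) (1 / u)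
      have a2 := norm_sub_le (oddGen (Complex.exp (-u))) (2 / u ^ 2)
      have a3 : ‖(1 : ℂ) / u‖ = 1 / ‖u‖ := by simp
      have a4 : ‖2 / 3 * Complex.exp (-u)‖ ≤ 2 / 3 * (2 / ‖u‖) := by
        rw [norm_mul]
        have : ‖(2 / 3 : ℂ)‖ = 2 / 3 := by norm_num
        rw [this]
        gcongr
      have a5 : 37 / ‖u‖ = 30 / ‖u‖ + 4 / ‖u‖ + 1 / ‖u‖ + 2 * (1 / ‖u‖) := by ring
      have a6 : 2 / 3 * (2 / ‖u‖) ≤ 2 * (1 / ‖u‖) := by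
        have : 0 < 1 / ‖u‖ := by positivity
        have e : 2 / 3 * (2 / ‖u‖) = 4 / 3 * (1 / ‖u‖) := by ring
        rw [e]
        linarith
      rw [a5]
      linarith
    calc ‖rho u‖ * (1 + ‖u‖ ^ 2) ≤ 37 / ‖u‖ / ‖u‖ * (1 + ‖u‖ ^ 2) := by gcongr
      _ ≤ 185 := by
        rw [div_div, div_mul_eq_mul_div, div_le_iff₀ (by positivity)]
        nlinarith

open MeasureTheory in
lemma mul_tsum_eq_integral_ceil {t : ℝ} (ht : 0 < t) (f : ℕ → ℂ)
    (hf : IntegrableOn (fun u : ℝ => f ⌈u / t⌉₊) (Set.Ioi 0)) :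
    t * ∑' m : ℕ, f (m + 1) = ∫ u in Set.Ioi (0 : ℝ), f ⌈u / t⌉₊ := by
  let g : ℕ → ℝ := fun m => m * t
  have hmono : Monotone g := fun a b h => by
    simp only [g]
    gcongr
  have hU : ⋃ m : ℕ, Set.Ioc (g m) (g (m + 1)) = Set.Ioi 0 := by
    have h := iUnion_Ioc_map_succ_eq_Ioi (f := g) (fun a => hmono bot_le) ?_
    · simpa [g] using h
    · rintro ⟨B, hB⟩
      obtain ⟨m, hm⟩ := exists_nat_gt (B / t)
      have h1 : g m ≤ B := hB ⟨m, rfl⟩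
      rw [div_lt_iff₀ ht] at hm
      exact absurd h1 (not_le.mpr hm)
  have h := hasSum_integral_iUnion (μ := volume) (f := fun u : ℝ => f ⌈u / t⌉₊)
    (s := fun m : ℕ => Set.Ioc (g m) (g (m + 1)))
    (fun _ => measurableSet_Ioc) hmono.pairwise_disjoint_on_Ioc_succ (by rwa [hU])
  rw [hU] at h
  rw [← h.tsum_eq, ← tsum_mul_left]
  refine tsum_congr (fun m => ?_)
  rw [setIntegral_congr_fun (g := fun _ => f (m + 1)) measurableSet_Ioc]
  · simp [g, add_mul, ht.le]
  · intro u hu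
    have : ⌈u / t⌉₊ = m + 1 := by
      rw [Nat.ceil_eq_iff (by omega), lt_div_iff₀ ht, div_le_iff₀ ht]
      simpa [g] using hu
    simp only [this]

open MeasureTheory in
lemma tendsto_mul_tsum_rho {ι : Type*} {l : Filter ι} [l.IsCountablyGenerated] {t : ι → ℝ}
    {c : ι → ℂ} (ht : Tendsto t l (𝓝[>] 0)) (hc : Tendsto c l (𝓝 1)) :
    Tendsto (fun i => (t i : ℂ) * ∑' m : ℕ, rho ((m + 1 : ℕ) * (t i * c i))) l
      (𝓝 (∫ u in Set.Ioi (0 : ℝ), rho u)) := by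
  obtain ⟨C, hC0, hC⟩ := rho_bound
  have htpos : ∀ᶠ i in l, 0 < t i := ht.eventually self_mem_nhdsWithin
  have ht0 : Tendsto t l (𝓝 0) := tendsto_nhds_of_tendsto_nhdsWithin ht
  have hcs : ∀ᶠ i in l, 1 / 2 ≤ (c i).re ∧ |(c i).im| ≤ 1 / 2 := by
    have h1 : Tendsto (fun i => (c i).re) l (𝓝 1) := (Complex.continuous_re.tendsto _).comp hc
    have h2 : Tendsto (fun i => |(c i).im|) l (𝓝 0) := by
      simpa [Function.comp_def] using ((continuous_abs.comp Complex.continuous_im).tendsto _).comp hc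
    exact (h1.eventually_const_le (by norm_num)).and (h2.eventually_le_const (by norm_num))
  let F : ι → ℝ → ℂ := fun i u => rho ((⌈u / t i⌉₊ : ℕ) * (t i * c i))
  have hmeas : ∀ i, AEStronglyMeasurable (F i) (volume.restrict (Set.Ioi 0)) := by
    intro i
    have h1 : Measurable (fun m : ℕ => rho ((m : ℂ) * (t i * c i))) := measurable_from_top
    exact (h1.comp (Nat.measurable_ceil.comp (measurable_id.div_const _))).aestronglyMeasurable
  have hbound : ∀ᶠ i in l, ∀ u ∈ Set.Ioi (0 : ℝ), ‖F i u‖ ≤ 4 * C * (1 + u ^ 2)⁻¹ := by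
    filter_upwards [htpos, hcs] with i hi hci u hu
    have hu : 0 < u := hu
    have hceil : u ≤ (⌈u / t i⌉₊ : ℝ) * t i := by
      rw [← div_le_iff₀ hi]
      exact Nat.le_ceil _
    set x : ℝ := (⌈u / t i⌉₊ : ℝ) * t i with hx
    have hx0 : 0 < x := hu.trans_le hceil
    have e : ((⌈u / t i⌉₊ : ℕ) : ℂ) * (t i * c i) = (x : ℂ) * c i := by
      rw [hx]
      push_cast
      ring
    have hre : ((x : ℂ) * c i).re = x * (c i).re := Complex.re_ofReal_mul _ _
    have him : ((x : ℂ) * c i).im = x * (c i).im := Complex.im_ofReal_mul _ _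
    simp only [F, e]
    refine (hC _ ?_ ?_).trans ?_
    · rw [hre]
      exact mul_pos hx0 (by linarith)
    · rw [hre, him, abs_mul, abs_of_pos hx0]
      gcongr
      linarith
    · have hn : u / 2 ≤ ‖(x : ℂ) * c i‖ := by
        refine le_trans ?_ (Complex.re_le_norm _)
        rw [hre]
        nlinarith
      rw [← div_eq_mul_inv, div_le_div_iff₀ (by positivity) (by positivity)]
      have : (u / 2) ^ 2 ≤ ‖(x : ℂ) * c i‖ ^ 2 := by gcongr
      nlinarith
  have h_int : IntegrableOn (fun u : ℝ => 4 * C * (1 + u ^ 2)⁻¹) (Set.Ioi 0) :=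
    (integrable_inv_one_add_sq.const_mul _).integrableOn
  have hlim : ∀ u ∈ Set.Ioi (0 : ℝ), Tendsto (fun i => F i u) l (𝓝 (rho u)) := by
    intro u hu
    have hu : 0 < u := hu
    have h1 : Tendsto (fun i => (⌈u / t i⌉₊ : ℝ) * t i) l (𝓝 u) := by
      have hb : Tendsto (fun i => u + t i) l (𝓝 u) := by simpa using ht0.const_add u
      refine tendsto_of_tendsto_of_tendsto_of_le_of_le' tendsto_const_nhds hb ?_ ?_
      · filter_upwards [htpos] with i hi
        rw [← div_le_iff₀ hi]
        exact Nat.le_ceil _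
      · filter_upwards [htpos] with i hi
        have h := (Nat.ceil_lt_add_one (div_pos hu hi).le).le
        calc (⌈u / t i⌉₊ : ℝ) * t i ≤ (u / t i + 1) * t i := by gcongr
          _ = u + t i := by field_simp
    have h2 : Tendsto (fun i => (⌈u / t i⌉₊ : ℂ) * (t i * c i)) l (𝓝 u) := by
      have h3 := ((Complex.continuous_ofReal.tendsto u).comp h1).mul hc
      rw [mul_one] at h3
      refine h3.congr (fun i => ?_)
      simp only [Function.comp]
      push_cast
      ring
    exact (continuousAt_rho (by simpa using hu)).tendsto.comp h2
  have hmain := tendsto_integral_filter_of_dominated_convergence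
    (μ := volume.restrict (Set.Ioi (0 : ℝ))) (F := F) _
    (Eventually.of_forall hmeas)
    (hbound.mono fun i hi => (ae_restrict_iff' measurableSet_Ioi).mpr (Eventually.of_forall hi))
    h_int ((ae_restrict_iff' measurableSet_Ioi).mpr (Eventually.of_forall hlim))
  refine hmain.congr' ?_
  filter_upwards [htpos, hbound] with i hi hbi
  refine (mul_tsum_eq_integral_ceil hi (fun m => rho (m * (t i * c i))) ?_).symm
  exact h_int.mono' (hmeas i)
    ((ae_restrict_iff' measurableSet_Ioi).mpr (Eventually.of_forall hbi))

lemma hasSum_zeta {k : ℕ} (hk : 1 < k) :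
    HasSum (fun m : ℕ => 1 / ((m : ℂ) + 1) ^ k) (riemannZeta k) := by
  have hs : Summable (fun n : ℕ => 1 / (n : ℂ) ^ k) := by
    refine Summable.of_norm ?_
    simpa using Real.summable_nat_pow_inv.mpr hk
  have h := hs.hasSum
  rw [← zeta_nat_eq_tsum_of_gt_one hk, ← hasSum_nat_add_iff' 1] at h
  have hk0 : k ≠ 0 := by omega
  simpa [hk0] using h

lemma logGen_exp_neg {τ : ℂ} (hτ : 0 < τ.re) :
    logGen (Complex.exp (-τ)) = 2 * riemannZeta 3 / τ ^ 2 + riemannZeta 2 / τ +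
      2 / 3 * Complex.log (1 - Complex.exp (-τ)) + τ * ∑' m : ℕ, rho ((m + 1 : ℕ) * τ) := by
  have h0 := ne_zero_of_re_pos hτ
  have hz := norm_exp_neg_lt hτ
  have hlog : HasSum (fun m : ℕ => Complex.exp (-τ) ^ (m + 1) / (m + 1))
      (-Complex.log (1 - Complex.exp (-τ))) := by
    have := (hasSum_nat_add_iff' 1).mpr (Complex.hasSum_taylorSeries_neg_log hz)
    simpa using this
  have h := (((hasSum_logGen hz).sub ((hasSum_zeta (k := 3) (by norm_num)).mul_left (2 / τ ^ 2))).sub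
    ((hasSum_zeta (k := 2) (by norm_num)).mul_left (1 / τ))).add (hlog.mul_left (2 / 3))
  have h' : HasSum (fun m : ℕ => τ * rho ((m + 1 : ℕ) * τ)) _ := h.congr_fun (fun m => ?_)
  · rw [← tsum_mul_left, h'.tsum_eq]
    push_cast
    ring
  · have hm : (m + 1 : ℂ) ≠ 0 := Nat.cast_add_one_ne_zero m
    rw [rho, oddRem, ← Complex.exp_nat_mul]
    have e : ((m + 1 : ℕ) : ℂ) * -τ = -(((m + 1 : ℕ) : ℂ) * τ) := by ring
    rw [e]
    push_cast
    field_simp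

lemma tendsto_logGen {ι : Type*} {l : Filter ι} [l.IsCountablyGenerated] {t : ι → ℝ}
    {c : ι → ℂ} (ht : Tendsto t l (𝓝[>] 0)) (hc : Tendsto c l (𝓝 1)) :
    Tendsto (fun i => logGen (Complex.exp (-(t i * c i))) - 2 * riemannZeta 3 / (t i * c i) ^ 2 -
      riemannZeta 2 / (t i * c i) - 2 / 3 * (Real.log (t i) : ℂ)) l
      (𝓝 (∫ u in Set.Ioi (0 : ℝ), rho u)) := by
  have htpos : ∀ᶠ i in l, 0 < t i := ht.eventually self_mem_nhdsWithin
  have ht0 : Tendsto t l (𝓝 0) := tendsto_nhds_of_tendsto_nhdsWithin ht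
  have hcs : ∀ᶠ i in l, 0 < (c i).re := by
    have h1 : Tendsto (fun i => (c i).re) l (𝓝 1) := (Complex.continuous_re.tendsto _).comp hc
    exact h1.eventually_const_lt (by norm_num)
  have hpos : ∀ᶠ i in l, 0 < ((t i : ℂ) * c i).re := by
    filter_upwards [htpos, hcs] with i h1 h2
    rw [Complex.re_ofReal_mul]
    positivity
  have hτ : Tendsto (fun i => (t i : ℂ) * c i) l (𝓝 0) := by
    simpa using ((Complex.continuous_ofReal.tendsto 0).comp ht0).mul hc
  have hτ' : Tendsto (fun i => (t i : ℂ) * c i) l (𝓝[≠] 0) :=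
    tendsto_nhdsWithin_iff.mpr ⟨hτ, hpos.mono fun i hi => ne_zero_of_re_pos hi⟩
  have hd : HasDerivAt (fun u : ℂ => 1 - Complex.exp (-u)) 1 0 := by
    have := ((Complex.hasDerivAt_exp (-0)).comp (0 : ℂ) (hasDerivAt_neg (0 : ℂ))).const_sub 1
    simpa [Function.comp_def] using this
  have hq : Tendsto (fun i => c i * (((t i : ℂ) * c i)⁻¹ *
      (1 - Complex.exp (-((t i : ℂ) * c i))))) l (𝓝 1) := by
    have h1 := hd.tendsto_slope_zero.comp hτ'
    simpa [Function.comp_def] using hc.mul h1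
  have hlog := ((continuousAt_clog (by simp)).tendsto.comp hq).const_mul (2 / 3)
  have hsum := hc.mul (tendsto_mul_tsum_rho ht hc)
  have htot := hlog.add hsum
  simp only [Complex.log_one, mul_zero, zero_add, one_mul] at htot
  refine htot.congr' ?_
  filter_upwards [htpos, hpos] with i hi hi2
  have h1 := one_sub_exp_neg_ne_zero hi2
  have h2 := ne_zero_of_re_pos hi2
  have h3 : c i ≠ 0 := right_ne_zero_of_mul h2
  have h4 : (t i : ℂ) ≠ 0 := left_ne_zero_of_mul h2
  have e : 1 - Complex.exp (-((t i : ℂ) * c i)) = (t i : ℂ) * (c i * (((t i : ℂ) * c i)⁻¹ *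
      (1 - Complex.exp (-((t i : ℂ) * c i))))) := by
    field_simp
  have hlg := congrArg Complex.log e
  rw [Complex.log_ofReal_mul hi (by
    intro h
    rw [h, mul_zero] at e
    exact h1 e)] at hlg
  rw [logGen_exp_neg hi2, hlg]
  simp only [Function.comp]
  ring

/-- The polar part of `oddGen (exp (-u))` at `u = 0`. -/
noncomputable def polePart (u : ℝ) : ℂ := 2 / (u : ℂ) ^ 2 + 1 / u

/-- `oddGen (exp (-u))`, corrected so that only its polar part at `0` remains unbounded. -/
noncomputable def expGen (u : ℝ) : ℂ :=
  oddGen (Complex.exp (-u)) + 2 / 3 * Complex.exp (-u)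

/-- `expGen` with its polar part removed on `(0, 1]` only. -/
noncomputable def cutGen (u : ℝ) : ℂ := u * rho u + (Set.Ioi 1).indicator polePart u

lemma mul_rho {u : ℝ} (hu : 0 < u) : (u : ℂ) * rho u = expGen u - polePart u := by
  have : (u : ℂ) ≠ 0 := by exact_mod_cast hu.ne'
  rw [rho, oddRem, expGen, polePart, mul_div_cancel₀ _ this]
  ring

lemma expGen_eq {u : ℝ} (hu : 0 < u) :
    expGen u = cutGen u + (Set.Ioc 0 1).indicator polePart u := by
  rw [cutGen, mul_rho hu]
  by_cases h : u ≤ 1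
  · rw [Set.indicator_of_notMem (by simpa using h), Set.indicator_of_mem (show u ∈ Set.Ioc (0 : ℝ) 1 from ⟨hu, h⟩)]
    ring
  · rw [Set.indicator_of_mem (by simpa using h), Set.indicator_of_notMem (fun h' => h h'.2)]
    ring

lemma continuousOn_rho_ofReal : ContinuousOn (fun u : ℝ => rho u) (Set.Ioi 0) := by
  intro u hu
  have : ContinuousAt rho (u : ℂ) := continuousAt_rho (by simpa using hu)
  exact (ContinuousAt.comp (f := fun u : ℝ => (u : ℂ)) this
    Complex.continuous_ofReal.continuousAt).continuousWithinAt

open MeasureTheory in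
lemma integrableOn_rho : IntegrableOn (fun u : ℝ => rho u) (Set.Ioi 0) := by
  obtain ⟨C, hC0, hC⟩ := rho_bound
  have h_int : IntegrableOn (fun u : ℝ => C * (1 + u ^ 2)⁻¹) (Set.Ioi 0) :=
    (integrable_inv_one_add_sq.const_mul _).integrableOn
  refine h_int.mono' (continuousOn_rho_ofReal.aestronglyMeasurable measurableSet_Ioi) ?_
  refine (ae_restrict_iff' measurableSet_Ioi).mpr (Eventually.of_forall fun u hu => ?_)
  have hu : 0 < u := hu
  refine (hC u (by simpa using hu) (by simpa using hu.le)).trans_eq ?_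
  rw [Complex.norm_real, Real.norm_eq_abs, sq_abs, div_eq_mul_inv]

lemma continuousOn_polePart : ContinuousOn polePart (Set.Ioi 0) := by
  intro u hu
  have : (u : ℂ) ≠ 0 := by exact_mod_cast (ne_of_gt hu)
  unfold polePart
  apply ContinuousAt.continuousWithinAt
  fun_prop (disch := simpa using this)

open MeasureTheory in
lemma locallyIntegrableOn_cutGen : LocallyIntegrableOn cutGen (Set.Ioi 0) := by
  have h1 : LocallyIntegrableOn (fun u : ℝ => (u : ℂ) * rho u) (Set.Ioi 0) :=
    (Complex.continuous_ofReal.continuousOn.mul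
      continuousOn_rho_ofReal).locallyIntegrableOn measurableSet_Ioi
  have h2 := continuousOn_polePart.locallyIntegrableOn (μ := volume) measurableSet_Ioi
  have h3 : LocallyIntegrableOn ((Set.Ioi 1).indicator polePart) (Set.Ioi 0) := fun x hx =>
    let ⟨s, hs, h⟩ := h2 x hx
    ⟨s, hs, h.indicator measurableSet_Ioi⟩
  exact h1.add h3

lemma cutGen_isBigO_atTop : cutGen =O[atTop] fun u => Real.exp (-1 * u) := by
  refine Asymptotics.IsBigO.of_bound 13 ?_
  filter_upwards [eventually_gt_atTop 1] with u hu
  have hu0 : 0 < u := by linarith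
  have e : cutGen u = expGen u := by
    rw [expGen_eq hu0, Set.indicator_of_notMem (fun h => not_le.mpr hu h.2), add_zero]
  have hz := norm_exp_neg_lt (u := (u : ℂ)) (by simpa using hu0)
  have hn : ‖Complex.exp (-(u : ℂ))‖ = Real.exp (-u) := by
    rw [Complex.norm_exp]
    simp
  have hs : Real.exp (-u) ≤ 1 / 2 := by
    rw [Real.exp_neg, inv_eq_one_div]
    exact one_div_le_one_div_of_le (by norm_num) (by linarith [Real.add_one_le_exp u])
  have h1 := norm_oddGen_le_div hz
  rw [hn] at h1
  have hp := Real.exp_pos (-u)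
  have h2 : 3 * Real.exp (-u) / (1 - Real.exp (-u)) ^ 2 ≤ 12 * Real.exp (-u) := by
    rw [div_le_iff₀ (by nlinarith)]
    nlinarith [mul_nonneg hp.le (by nlinarith : 0 ≤ (1 - Real.exp (-u)) ^ 2 - 1 / 4)]
  have h3 : ‖(2 / 3 : ℂ) * Complex.exp (-(u : ℂ))‖ = 2 / 3 * Real.exp (-u) := by
    rw [norm_mul, hn]
    norm_num
  rw [e, expGen, neg_one_mul, Real.norm_of_nonneg hp.le]
  refine (norm_add_le _ _).trans ?_
  rw [h3]
  linarith

lemma cutGen_isBigO_zero : cutGen =O[𝓝[>] 0] fun u : ℝ => u ^ (-(-1) : ℝ) := by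
  obtain ⟨C, hC0, hC⟩ := rho_bound
  refine Asymptotics.IsBigO.of_bound C ?_
  filter_upwards [Ioo_mem_nhdsGT (zero_lt_one' ℝ)] with u hu
  rw [cutGen, Set.indicator_of_notMem (by simpa using hu.2.le), add_zero, neg_neg, Real.rpow_one,
    norm_mul, Complex.norm_real, mul_comm]
  gcongr
  refine (hC u (by simpa using hu.1) (by simpa using hu.1.le)).trans ?_
  exact div_le_self hC0.le (by nlinarith [sq_nonneg ‖(u : ℂ)‖])

lemma mellinConvergent_cutGen {s : ℂ} (hs : -1 < s.re) : MellinConvergent cutGen s :=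
  mellinConvergent_of_isBigO_rpow_exp one_pos locallyIntegrableOn_cutGen cutGen_isBigO_atTop
    cutGen_isBigO_zero hs

lemma differentiableAt_mellin_cutGen {s : ℂ} (hs : -1 < s.re) :
    DifferentiableAt ℂ (mellin cutGen) s :=
  mellin_differentiableAt_of_isBigO_rpow_exp one_pos locallyIntegrableOn_cutGen cutGen_isBigO_atTop
    cutGen_isBigO_zero hs

lemma hasMellin_polePart {s : ℂ} (hs : 2 < s.re) :
    HasMellin ((Set.Ioc 0 1).indicator polePart) s (2 / (s - 2) + 1 / (s - 1)) := by
  have h2 := hasMellin_cpow_Ioc (-2) (s := s) (by simpa using by linarith)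
  have h1 := hasMellin_cpow_Ioc (-1) (s := s) (by simpa using by linarith)
  have h2' := hasMellin_const_smul h2.1 (2 : ℂ)
  have h := hasMellin_add h2'.1 h1.1
  rw [h2'.2, h2.2, h1.2] at h
  convert! h using 1
  · funext u
    by_cases hu : u ∈ Set.Ioc (0 : ℝ) 1
    · simp only [Set.indicator_of_mem hu, polePart, smul_eq_mul, Complex.cpow_neg, Complex.cpow_one]
      norm_cast
      simp [div_eq_mul_inv]
    · simp [Set.indicator_of_notMem hu]
  · simp only [smul_eq_mul]
    ring

lemma hasSum_zeta_cpow {s : ℂ} (hs : 1 < s.re) :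
    HasSum (fun k : ℕ => 1 / ((k + 1 : ℕ) : ℂ) ^ s) (riemannZeta s) := by
  have h := (Complex.summable_one_div_nat_cpow.mpr hs)
  have h2 := ((summable_nat_add_iff 1).mpr h).hasSum
  convert! h2 using 1
  rw [zeta_eq_tsum_one_div_nat_add_one_cpow hs]
  simp

lemma mellin_expGen {s : ℂ} (hs : 2 < s.re) :
    mellin expGen s = Complex.Gamma s * (2 * riemannZeta (s - 1) + riemannZeta s + 2 / 3) := by
  let a : ℕ → ℂ := fun k => 2 * k + 3 + if k = 0 then 2 / 3 else 0
  let p : ℕ → ℝ := fun k => k + 1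
  have hp : ∀ k, 0 < p k := fun k => by positivity
  have hF : ∀ u ∈ Set.Ioi (0 : ℝ), HasSum (fun k => a k * Real.exp (-p k * u)) (expGen u) := by
    intro u hu
    have hz := norm_exp_neg_lt (u := (u : ℂ)) (by simpa using hu)
    have h2 := hasSum_ite_eq (0 : ℕ) (2 / 3 * Complex.exp (-(u : ℂ)))
    refine ((hasSum_odd_mul_pow hz).add h2).congr_fun (fun k => ?_)
    simp only [a, p]
    rw [← Complex.exp_nat_mul]
    split_ifs with hk
    · subst hk
      push_cast
      simp
      ring
    · push_cast
      ring_nf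
  have hmain : HasSum (fun k => a k / (p k : ℂ) ^ s)
      (2 * riemannZeta (s - 1) + riemannZeta s + 2 / 3) := by
    have h1 := (hasSum_zeta_cpow (s := s - 1) (by simpa using by linarith)).mul_left 2
    have h2 := hasSum_zeta_cpow (s := s) (by linarith)
    refine ((h1.add h2).add (hasSum_ite_eq (0 : ℕ) (2 / 3 : ℂ))).congr_fun (fun k => ?_)
    have hk : ((k + 1 : ℕ) : ℂ) ≠ 0 := Nat.cast_ne_zero.mpr k.succ_ne_zero
    have e : ((p k : ℝ) : ℂ) = ((k + 1 : ℕ) : ℂ) := by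
      simp [p]
    rw [e, Complex.cpow_sub _ _ hk, Complex.cpow_one]
    have hc : ((k + 1 : ℕ) : ℂ) ^ s ≠ 0 := by
      simp only [ne_eq, Complex.cpow_eq_zero_iff, hk, false_and, not_false_eq_true]
    simp only [a]
    split_ifs with h0
    · subst h0
      simp
      ring
    · field_simp
      push_cast
      ring
  refine ((hasSum_mellin (fun k => Or.inr (hp k)) (by linarith) hF ?_).congr_fun ?_).unique
    (hmain.mul_left (Complex.Gamma s))
  · refine hmain.summable.norm.congr (fun k => ?_)
    rw [norm_div, Complex.norm_cpow_eq_rpow_re_of_pos (hp k)]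
  · intro k
    ring

lemma mellin_cutGen {s : ℂ} (hs : 2 < s.re) :
    mellin cutGen s = Complex.Gamma s * (2 * riemannZeta (s - 1) + riemannZeta s + 2 / 3) -
      (2 / (s - 2) + 1 / (s - 1)) := by
  have hP := hasMellin_polePart hs
  have h := (hasMellin_add (mellinConvergent_cutGen (s := s) (by linarith)) hP.1).2
  rw [hP.2] at h
  rw [← mellin_expGen hs, eq_sub_iff_add_eq, ← h]
  refine MeasureTheory.setIntegral_congr_fun measurableSet_Ioi (fun u hu => ?_)
  simp only [expGen_eq hu]

lemma mellin_cutGen_of_im_pos {s : ℂ} (hs : -1 < s.re) (hs' : 0 < s.im) :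
    mellin cutGen s = Complex.Gamma s * (2 * riemannZeta (s - 1) + riemannZeta s + 2 / 3) -
      (2 / (s - 2) + 1 / (s - 1)) := by
  let U : Set ℂ := {s | -1 < s.re} ∩ {s | 0 < s.im}
  have hU : IsOpen U := (isOpen_lt continuous_const Complex.continuous_re).inter
    (isOpen_lt continuous_const Complex.continuous_im)
  have hUc : IsPreconnected U :=
    ((convex_halfSpace_re_gt _).inter (convex_halfSpace_im_gt _)).isPreconnected
  have hne : ∀ s ∈ U, ∀ r : ℝ, s ≠ r := by
    rintro s ⟨-, h⟩ r rfl
    simp at h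
  refine AnalyticOnNhd.eqOn_of_preconnected_of_eventuallyEq (𝕜 := ℂ) (U := U) (z₀ := 3 + Complex.I)
    (f := mellin cutGen)
    (g := fun s => Complex.Gamma s * (2 * riemannZeta (s - 1) + riemannZeta s + 2 / 3) -
      (2 / (s - 2) + 1 / (s - 1))) ?_ ?_ hUc ?_ ?_ ⟨hs, hs'⟩
  · exact DifferentiableOn.analyticOnNhd
      (fun s hs => (differentiableAt_mellin_cutGen hs.1).differentiableWithinAt) hU
  · refine DifferentiableOn.analyticOnNhd (fun s hs => ?_) hU
    have e1 : s - 1 ≠ 0 := sub_ne_zero.mpr (by simpa using hne s hs 1)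
    have e2 : s - 2 ≠ 0 := sub_ne_zero.mpr (by simpa using hne s hs 2)
    have d0 : DifferentiableAt ℂ Complex.Gamma s :=
      Complex.differentiableAt_Gamma _ (fun m => by simpa using hne s hs (-m))
    have d1 : DifferentiableAt ℂ riemannZeta s :=
      differentiableAt_riemannZeta (by simpa using hne s hs 1)
    have d2 : DifferentiableAt ℂ (fun s => riemannZeta (s - 1)) s := by
      refine DifferentiableAt.comp s (differentiableAt_riemannZeta ?_) (by fun_prop)
      intro h
      exact e2 (by linear_combination h)
    apply DifferentiableAt.differentiableWithinAt
    fun_prop (disch := assumption)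
  · simp [U]
    norm_num
  · have : {s : ℂ | 2 < s.re} ∈ 𝓝 (3 + Complex.I) :=
      (isOpen_lt continuous_const Complex.continuous_re).mem_nhds (by simp; norm_num)
    filter_upwards [this] with s hs using mellin_cutGen hs

lemma mellin_cutGen_zero :
    mellin cutGen 0 = 2 * deriv riemannZeta (-1) + deriv riemannZeta 0 + 2 := by
  have hz1 : riemannZeta (-1) = -1 / 12 := by
    have := riemannZeta_neg_nat_eq_bernoulli 1
    norm_num [bernoulli_two] at this
    rw [this]
    norm_num
  let D : ℂ → ℂ := fun s => 2 * riemannZeta (s - 1) + riemannZeta s + 2 / 3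
  have hD0 : D 0 = 0 := by
    simp only [D, zero_sub, hz1, riemannZeta_zero]
    norm_num
  have hD : HasDerivAt D (2 * deriv riemannZeta (-1) + deriv riemannZeta 0) 0 := by
    have d1 : HasDerivAt riemannZeta (deriv riemannZeta (-1)) (0 - 1) := by
      rw [zero_sub]
      exact (differentiableAt_riemannZeta (by norm_num)).hasDerivAt
    have d0 : HasDerivAt riemannZeta (deriv riemannZeta 0) 0 :=
      (differentiableAt_riemannZeta (by norm_num)).hasDerivAt
    exact (((d1.comp_sub_const 0 1).const_mul 2).add d0).add_const _
  let p : ℝ → ℂ := fun ε => ε * Complex.I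
  have hp0 : Tendsto p (𝓝[>] 0) (𝓝 0) := by
    have : Continuous p := by fun_prop
    have := this.tendsto 0
    simp only [p, Complex.ofReal_zero, zero_mul] at this
    exact tendsto_nhdsWithin_of_tendsto_nhds this
  have hp : Tendsto p (𝓝[>] 0) (𝓝[≠] 0) := by
    refine tendsto_nhdsWithin_iff.mpr ⟨hp0, ?_⟩
    filter_upwards [self_mem_nhdsWithin] with ε hε
    simpa [p] using ne_of_gt hε
  have hslope : Tendsto (fun s : ℂ => s⁻¹ * D s) (𝓝[≠] 0)
      (𝓝 (2 * deriv riemannZeta (-1) + deriv riemannZeta 0)) := by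
    simpa [hD0] using hD.tendsto_slope_zero
  have hG : ContinuousAt (fun s => Complex.Gamma (s + 1)) 0 := by
    have : DifferentiableAt ℂ Complex.Gamma (0 + 1) := by
      rw [zero_add]
      exact Complex.differentiableAt_Gamma_one
    exact ContinuousAt.comp (f := fun s : ℂ => s + 1) this.continuousAt (by fun_prop)
  have hr : ContinuousAt (fun s : ℂ => 2 / (s - 2) + 1 / (s - 1)) 0 := by
    fun_prop (disch := norm_num)
  have lim1 := ((hG.tendsto.comp hp0).mul (hslope.comp hp)).sub (hr.tendsto.comp hp0)
  have lim2 : Tendsto (fun ε => mellin cutGen (p ε)) (𝓝[>] 0) (𝓝 (mellin cutGen 0)) :=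
    (differentiableAt_mellin_cutGen (s := 0) (by norm_num)).continuousAt.tendsto.comp hp0
  have heq : ∀ᶠ ε in 𝓝[>] 0, mellin cutGen (p ε) = Complex.Gamma (p ε + 1) * ((p ε)⁻¹ * D (p ε)) -
      (2 / (p ε - 2) + 1 / (p ε - 1)) := by
    filter_upwards [self_mem_nhdsWithin] with ε hε
    have hε : 0 < ε := hε
    have h0 : p ε ≠ 0 := by
      simpa [p] using ne_of_gt hε
    rw [mellin_cutGen_of_im_pos (by simp [p]) (by simpa [p] using hε), Complex.Gamma_add_one _ h0]
    simp only [D]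
    field_simp
  have := tendsto_nhds_unique (lim2.congr' heq) lim1
  rw [this]
  norm_num

open MeasureTheory in
lemma mellin_cutGen_zero_eq_integral :
    mellin cutGen 0 = (∫ u in Set.Ioi (0 : ℝ), rho u) + 2 := by
  have i3 := integral_Ioi_cpow_of_lt (a := -3) (c := 1) (by norm_num) one_pos
  have i2 := integral_Ioi_cpow_of_lt (a := -2) (c := 1) (by norm_num) one_pos
  have j3 := integrableOn_Ioi_cpow_of_lt (a := -3) (c := 1) (by norm_num) one_pos
  have j2 := integrableOn_Ioi_cpow_of_lt (a := -2) (c := 1) (by norm_num) one_pos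
  let g : ℝ → ℂ := fun u => 2 * (u : ℂ) ^ (-3 : ℂ) + (u : ℂ) ^ (-2 : ℂ)
  have hg : ∫ u in Set.Ioi (1 : ℝ), g u = 2 := by
    rw [integral_add (j3.const_mul 2) j2, integral_const_mul, i3, i2]
    norm_num
  have hgi : IntegrableOn g (Set.Ioi 1) := (j3.const_mul 2).add j2
  have hgi' : IntegrableOn ((Set.Ioi 1).indicator g) (Set.Ioi 0) :=
    (hgi.integrable_indicator measurableSet_Ioi).integrableOn
  have hg' : ∫ u in Set.Ioi (0 : ℝ), (Set.Ioi 1).indicator g u = 2 := by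
    rw [setIntegral_indicator measurableSet_Ioi, Set.Ioi_inter_Ioi, ← hg]
    norm_num
  rw [← hg', ← integral_add integrableOn_rho hgi', mellin]
  refine setIntegral_congr_fun measurableSet_Ioi (fun u hu => ?_)
  have h0 : (u : ℂ) ≠ 0 := by exact_mod_cast ne_of_gt hu
  simp only [cutGen, smul_eq_mul, zero_sub, Complex.cpow_neg_one, mul_add, inv_mul_cancel_left₀ h0]
  congr 1
  by_cases h : u ∈ Set.Ioi (1 : ℝ)
  · simp only [Set.indicator_of_mem h, g, polePart, Complex.cpow_neg]
    norm_cast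
    field_simp
  · simp [Set.indicator_of_notMem h]

lemma integral_rho : ∫ u in Set.Ioi (0 : ℝ), rho u =
    2 * deriv riemannZeta (-1) + deriv riemannZeta 0 := by
  have := mellin_cutGen_zero_eq_integral
  rw [mellin_cutGen_zero] at this
  exact (add_right_cancel this).symm

lemma integral_exp_int_mul_I {k : ℤ} (hk : k ≠ 0) :
    ∫ θ in (-π)..π, Complex.exp (k * Complex.I * (θ : ℂ)) = 0 := by
  have hc : (k : ℂ) * Complex.I ≠ 0 := by simpa using hk
  rw [integral_exp_mul_complex hc, div_eq_zero_iff, sub_eq_zero]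
  refine Or.inl (Complex.exp_eq_exp_iff_exists_int.mpr ⟨k, ?_⟩)
  push_cast
  ring

lemma integral_exp_logGen {t : ℝ} (ht : 0 < t) (n : ℕ) :
    ∫ θ in (-π)..π, Complex.exp (logGen (Complex.exp (-((t : ℂ) + θ * Complex.I))) +
      n * (t + θ * Complex.I)) = 2 * π * pk (1 / 2) n := by
  let F : ℕ → ℝ → ℂ := fun m θ => pk (1 / 2) m * Complex.exp (-((t : ℂ) + θ * Complex.I)) ^ m *
    Complex.exp (n * (t + θ * Complex.I))
  let bound : ℕ → ℝ → ℝ := fun m _ => pk (1 / 2) m * Real.exp (-t) ^ m * Real.exp (n * t)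
  have hr : Real.exp (-t) < 1 := by simpa using ht
  have hsum : Summable (fun m => (pk (1 / 2) m * Real.exp (-t) ^ m * Real.exp (n * t) : ℝ)) :=
    (summable_pk (Real.exp_pos _).le hr).mul_right _
  have h := intervalIntegral.hasSum_integral_of_dominated_convergence (a := -π) (b := π)
    (μ := MeasureTheory.volume) (F := F)
    (f := fun θ : ℝ => Complex.exp (logGen (Complex.exp (-((t : ℂ) + θ * Complex.I))) +
      n * (t + θ * Complex.I))) bound ?_ ?_ ?_ ?_ ?_
  · refine h.unique ?_
    have hF : ∀ m, ∫ θ in (-π)..π, F m θ = if m = n then 2 * π * (pk (1 / 2) n : ℂ) else 0 := by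
      intro m
      have e : ∀ θ : ℝ, F m θ = pk (1 / 2) m * Complex.exp (((n : ℂ) - m) * t) *
          Complex.exp ((((n : ℤ) - m : ℤ) : ℂ) * Complex.I * (θ : ℂ)) := by
        intro θ
        simp only [F]
        rw [← Complex.exp_nat_mul, mul_assoc, ← Complex.exp_add, mul_assoc, ← Complex.exp_add]
        congr 2
        push_cast
        ring
      simp only [e]
      rw [intervalIntegral.integral_const_mul]
      split_ifs with hm
      · subst hm
        simp
        ring
      · rw [integral_exp_int_mul_I (by omega), mul_zero]
    simp only [hF]
    exact hasSum_ite_eq n _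
  · intro m
    exact Continuous.aestronglyMeasurable (by fun_prop)
  · intro m
    refine Eventually.of_forall (fun θ _ => ?_)
    simp only [F, bound, norm_mul, norm_pow, Complex.norm_natCast, Complex.norm_exp]
    simp
  · exact Eventually.of_forall (fun _ _ => hsum)
  · simp [bound]
  · refine Eventually.of_forall (fun θ _ => ?_)
    have hz := norm_exp_neg_lt (u := (t : ℂ) + θ * Complex.I) (by simpa using ht)
    rw [Complex.exp_add]
    exact (hasSum_pk hz).mul_right _

lemma re_logGen_sub_le {z : ℂ} (hz : ‖z‖ < 1) :
    (logGen z).re - (logGen (‖z‖ : ℝ)).re ≤ (oddGen z).re - (oddGen (‖z‖ : ℝ)).re := by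
  have hr : ‖((‖z‖ : ℝ) : ℂ)‖ < 1 := by simpa using hz
  have h := (Complex.hasSum_re (hasSum_logGen hr)).sub (Complex.hasSum_re (hasSum_logGen hz))
  have key : ∀ m : ℕ, 0 ≤ (oddGen (((‖z‖ : ℝ) : ℂ) ^ (m + 1)) / (m + 1)).re -
      (oddGen (z ^ (m + 1)) / (m + 1)).re := by
    intro m
    have e : (m + 1 : ℂ) = ((m + 1 : ℝ) : ℂ) := by push_cast; rfl
    rw [e, Complex.div_ofReal_re, Complex.div_ofReal_re, ← sub_div]
    refine div_nonneg (sub_nonneg.mpr ?_) (by positivity)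
    have := norm_oddGen_le (z := z ^ (m + 1)) (r := ‖z‖ ^ (m + 1)) (norm_pow _ _).le
      (pow_lt_one₀ (norm_nonneg _) hz m.succ_ne_zero)
    push_cast at this
    exact (Complex.re_le_norm _).trans this
  have := le_hasSum h 0 (fun m _ => key m)
  simp at this
  linarith

lemma re_oddGen_sub_le {z : ℂ} (hz : ‖z‖ < 1) :
    (oddGen z).re - (oddGen (‖z‖ : ℝ)).re ≤
      2 * ‖z‖ * (1 / ‖1 - z‖ ^ 2 - 1 / (1 - ‖z‖) ^ 2) := by
  have h1 : 0 < 1 - ‖z‖ := by linarith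
  have h2 : 1 - ‖z‖ ≤ ‖1 - z‖ := by simpa using norm_sub_norm_le (1 : ℂ) z
  have e : (oddGen (‖z‖ : ℝ)).re = 2 * ‖z‖ / (1 - ‖z‖) ^ 2 + ‖z‖ / (1 - ‖z‖) := by
    rw [oddGen]
    norm_cast
  have h3 : (2 * z / (1 - z) ^ 2).re ≤ 2 * ‖z‖ / ‖1 - z‖ ^ 2 := by
    refine (Complex.re_le_norm _).trans_eq ?_
    simp
  have h4 : (z / (1 - z)).re ≤ ‖z‖ / (1 - ‖z‖) := by
    refine (Complex.re_le_norm _).trans ?_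
    rw [norm_div]
    gcongr
  rw [e, oddGen, Complex.add_re]
  have : 2 * ‖z‖ * (1 / ‖1 - z‖ ^ 2 - 1 / (1 - ‖z‖) ^ 2) =
    2 * ‖z‖ / ‖1 - z‖ ^ 2 - 2 * ‖z‖ / (1 - ‖z‖) ^ 2 := by ring
  linarith

lemma exp_one_sub_abs_le (x : ℝ) :
    Real.exp (1 / 12 - |x| / 12) ≤ 400 * (1 + x ^ 2)⁻¹ := by
  rw [Real.exp_sub, ← div_eq_mul_inv]
  have hE := Real.quadratic_le_exp_of_nonneg (x := |x| / 12) (by positivity)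
  have hE' : Real.exp (1 / 12) ≤ 400 / 288 := by
    have h1 := Real.add_one_le_exp (-(1 / 12) : ℝ)
    rw [Real.exp_neg] at h1
    have h2 : (11 / 12 : ℝ) ≤ (Real.exp (1 / 12))⁻¹ := by linarith
    have h3 := inv_anti₀ (by norm_num) h2
    rw [inv_inv] at h3
    norm_num at h3 ⊢
    linarith
  have hx2 : (1 + x ^ 2) / 288 ≤ Real.exp (|x| / 12) := by
    refine le_trans ?_ hE
    rw [div_pow, sq_abs]
    nlinarith [abs_nonneg x, sq_nonneg x]
  calc Real.exp (1 / 12) / Real.exp (|x| / 12) ≤ (400 / 288) / ((1 + x ^ 2) / 288) := by gcongr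
    _ = 400 / (1 + x ^ 2) := by
      field_simp

lemma one_div_sub_one_div_lower_bound {t x q w : ℝ} (ht : 0 < t) (hx : t ^ 2 * |x| ≤ 4)
    (hq0 : 0 < q) (hq : q ≤ t ^ 2) (hw : q + (t ^ 2 * x) ^ 2 / 8 ≤ w) :
    max 0 ((|x| - 1) / 8) ≤ 1 / q - 1 / w := by
  have h1 : 1 / t ^ 2 - 1 / (t ^ 2 + (t ^ 2 * x) ^ 2 / 8) ≤ 1 / q - 1 / w := by
    have ha : 1 / w ≤ 1 / (q + (t ^ 2 * x) ^ 2 / 8) :=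
      one_div_le_one_div_of_le (by positivity) hw
    have hb : 1 / t ^ 2 - 1 / (t ^ 2 + (t ^ 2 * x) ^ 2 / 8) ≤
        1 / q - 1 / (q + (t ^ 2 * x) ^ 2 / 8) := by
      rw [div_sub_div _ _ (by positivity) (by positivity),
        div_sub_div _ _ (by positivity) (by positivity)]
      simp only [one_mul, mul_one, add_sub_cancel_left]
      gcongr
    linarith
  refine le_trans ?_ h1
  have e : 1 / t ^ 2 - 1 / (t ^ 2 + (t ^ 2 * x) ^ 2 / 8) = x ^ 2 / (8 + t ^ 2 * x ^ 2) := by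
    field_simp
    ring
  rw [e, max_le_iff]
  refine ⟨by positivity, ?_⟩
  rw [le_div_iff₀ (by positivity), ← sq_abs x]
  have h3 : t ^ 2 * |x| ^ 2 ≤ 4 * |x| := by
    nlinarith [abs_nonneg x]
  rcases le_total |x| 1 with h | h
  · nlinarith [abs_nonneg x, mul_nonneg (sub_nonneg.mpr h)
      (by positivity : (0 : ℝ) ≤ 8 + t ^ 2 * |x| ^ 2)]
  · nlinarith [mul_le_mul_of_nonneg_left h3 (sub_nonneg.mpr h)]

lemma exp_re_logGen_sub_le {t x : ℝ} (ht : 0 < t) (ht1 : t ≤ 1) (hx : t ^ 2 * |x| ≤ π) :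
    Real.exp ((logGen (Complex.exp (-((t : ℂ) + (t ^ 2 * x : ℝ) * Complex.I)))).re -
      (logGen (Complex.exp (-(t : ℂ)))).re) ≤ 400 * (1 + x ^ 2)⁻¹ := by
  set θ : ℝ := t ^ 2 * x with hθ
  set z := Complex.exp (-((t : ℂ) + θ * Complex.I)) with hzdef
  set r := Real.exp (-t) with hr
  have hnz : ‖z‖ = r := by
    rw [hzdef, Complex.norm_exp]
    simp [hr]
  have hr1 : r < 1 := by simpa [hr] using ht
  have hr0 : 0 < r := Real.exp_pos _
  have hr3 : 1 / 3 ≤ r := by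
    have h1 : Real.exp (-1) ≤ r := Real.exp_le_exp.mpr (by linarith)
    have h2 : 1 / 3 ≤ Real.exp (-1) := by
      rw [Real.exp_neg, inv_eq_one_div]
      exact one_div_le_one_div_of_le (Real.exp_pos _) (by linarith [Real.exp_one_lt_d9])
    linarith
  have hrt : 1 - r ≤ t := by
    have := Real.add_one_le_exp (-t)
    linarith
  have hzr : Complex.exp (-(t : ℂ)) = ((‖z‖ : ℝ) : ℂ) := by
    rw [hnz, hr]
    push_cast
    rfl
  have hA := (re_logGen_sub_le (z := z) (by rwa [hnz])).trans (re_oddGen_sub_le (by rwa [hnz]))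
  rw [← hzr, hnz] at hA
  have hθπ : |θ| ≤ π := by
    rw [hθ, abs_mul, abs_of_pos (by positivity)]
    exact hx
  have hcos := Real.cos_le_one_sub_mul_cos_sq hθπ
  have hz2 : ‖1 - z‖ ^ 2 = (1 - r) ^ 2 + 2 * r * (1 - Real.cos θ) := by
    have hzre : z.re = r * Real.cos θ := by
      rw [hzdef, Complex.exp_re]
      simp [hr]
    have hzim : z.im = -(r * Real.sin θ) := by
      rw [hzdef, Complex.exp_im]
      simp [hr]
    rw [← Complex.normSq_eq_norm_sq, Complex.normSq_apply]
    simp only [Complex.sub_re, Complex.one_re, Complex.sub_im, Complex.one_im, hzre, hzim]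
    nlinarith [Real.sin_sq_add_cos_sq θ]
  have hd : θ ^ 2 / 8 ≤ 2 * r * (1 - Real.cos θ) := by
    have hπ : π ^ 2 ≤ 10 := by nlinarith [Real.pi_lt_d2, Real.pi_pos]
    have h1 : θ ^ 2 / 5 ≤ 1 - Real.cos θ := by
      have : θ ^ 2 / 5 ≤ 2 / π ^ 2 * θ ^ 2 := by
        rw [div_mul_eq_mul_div, div_le_div_iff₀ (by norm_num) (by positivity)]
        nlinarith [sq_nonneg θ]
      linarith
    nlinarith [sq_nonneg θ]
  have hq : (1 - r) ^ 2 ≤ t ^ 2 := by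
    have : 0 ≤ 1 - r := by linarith
    gcongr
  set q := (1 - r) ^ 2 with hqdef
  have hq0 : 0 < q := by
    have : 0 < 1 - r := by linarith
    positivity
  have hδ := one_div_sub_one_div_lower_bound (x := x) (w := ‖1 - z‖ ^ 2) ht
    (by linarith [Real.pi_lt_d2]) hq0 hq (by
      rw [hz2, ← hθ]
      linarith)
  refine le_trans (Real.exp_le_exp.mpr ?_) (exp_one_sub_abs_le x)
  have hδ0 := (le_max_left _ _).trans hδ
  have hδ1 := (le_max_right _ _).trans hδ
  have hm := mul_nonneg (sub_nonneg.mpr hr3) hδ0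
  have e : 2 * r * (1 / ‖1 - z‖ ^ 2 - 1 / q) = -(2 * (r * (1 / q - 1 / ‖1 - z‖ ^ 2))) := by ring
  rw [e] at hA
  rw [sub_mul] at hm
  linarith

lemma measurable_exp_logGen {t : ℝ} (ht : 0 < t) :
    Measurable (fun θ : ℝ => Complex.exp (logGen (Complex.exp (-((t : ℂ) + θ * Complex.I))))) := by
  refine measurable_of_tendsto_metrizable (f := fun (N : ℕ) (θ : ℝ) => ∑ m ∈ Finset.range N,
    (pk (1 / 2) m : ℂ) * Complex.exp (-((t : ℂ) + θ * Complex.I)) ^ m) (fun N => ?_) ?_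
  · exact Continuous.measurable (by fun_prop)
  · rw [tendsto_pi_nhds]
    intro θ
    exact (hasSum_pk (norm_exp_neg_lt (u := (t : ℂ) + θ * Complex.I)
      (by simpa using ht))).tendsto_sum_nat

/-- The exponent of the rescaled Cauchy integrand, normalised by its main terms at the saddle
point. -/
noncomputable def saddleExponent (a b : ℝ) (n : ℕ) (t x : ℝ) : ℂ :=
  logGen (Complex.exp (-((t : ℂ) + (t ^ 2 * x : ℝ) * Complex.I))) +
    n * (t + (t ^ 2 * x : ℝ) * Complex.I) -
    ((a / t ^ 2 + b / t + 2 / 3 * Real.log t + n * t : ℝ) : ℂ)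

lemma integral_saddleExponent {a b t : ℝ} (n : ℕ) (ht : 0 < t) :
    ∫ x in (-(π / t ^ 2))..(π / t ^ 2), Complex.exp (saddleExponent a b n t x) =
      ((2 * π * pk (1 / 2) n / t ^ 2 *
        Real.exp (-(a / t ^ 2 + b / t + 2 / 3 * Real.log t + n * t)) : ℝ) : ℂ) := by
  have h := intervalIntegral.integral_comp_mul_left (a := -(π / t ^ 2)) (b := π / t ^ 2)
    (fun θ : ℝ => Complex.exp (logGen (Complex.exp (-((t : ℂ) + θ * Complex.I))) +
      n * (t + θ * Complex.I))) (c := t ^ 2) (by positivity)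
  have e1 : t ^ 2 * -(π / t ^ 2) = -π := by field_simp
  have e2 : t ^ 2 * (π / t ^ 2) = π := by field_simp
  rw [e1, e2, integral_exp_logGen ht] at h
  simp only [saddleExponent, sub_eq_add_neg _ ((_ : ℝ) : ℂ), ← Complex.ofReal_neg]
  simp only [Complex.exp_add _ ((_ : ℝ) : ℂ)]
  rw [intervalIntegral.integral_mul_const, h]
  push_cast
  rw [Complex.real_smul]
  push_cast
  ring

lemma re_saddleExponent (a b : ℝ) (n : ℕ) (t x : ℝ) :
    (saddleExponent a b n t x).re =
      ((logGen (Complex.exp (-((t : ℂ) + (t ^ 2 * x : ℝ) * Complex.I)))).re -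
        (logGen (Complex.exp (-(t : ℂ)))).re) +
      ((logGen (Complex.exp (-(t : ℂ)))).re - (a / t ^ 2 + b / t + 2 / 3 * Real.log t)) := by
  rw [saddleExponent, Complex.sub_re, Complex.add_re, Complex.ofReal_re]
  generalize t ^ 2 * x = θ
  simp

lemma tendsto_saddleExponent {a b : ℝ} (h3 : (a : ℂ) = 2 * riemannZeta 3)
    (h2 : (b : ℂ) = riemannZeta 2) {t : ℕ → ℝ} (ht : Tendsto t atTop (𝓝[>] 0))
    (hn : ∀ᶠ n : ℕ in atTop, n * t n ^ 3 = 2 * a) (x : ℝ) :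
    Tendsto (fun n => saddleExponent a b n (t n) x) atTop
      (𝓝 (-(3 * a) * (x : ℂ) ^ 2 + -(b * Complex.I) * x + ∫ u in Set.Ioi (0 : ℝ), rho u)) := by
  have ht0 : Tendsto t atTop (𝓝 0) := tendsto_nhds_of_tendsto_nhdsWithin ht
  have htC : Tendsto (fun n => (t n : ℂ)) atTop (𝓝 0) := by
    simpa [Function.comp_def] using (Complex.continuous_ofReal.tendsto 0).comp ht0
  let c : ℕ → ℂ := fun n => 1 + t n * x * Complex.I
  have hc : Tendsto c atTop (𝓝 1) := by
    simpa using ((htC.mul_const (x : ℂ)).mul_const Complex.I).const_add 1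
  have hL := tendsto_logGen ht hc
  have hA : Tendsto (fun n => (a : ℂ) * ((3 * (x * Complex.I) ^ 2 +
      2 * t n * (x * Complex.I) ^ 3) / c n ^ 2) - b * (x * Complex.I) / c n) atTop
      (𝓝 (-(3 * a) * (x : ℂ) ^ 2 + -(b * Complex.I) * x)) := by
    have := (((((htC.const_mul 2).mul_const ((x * Complex.I) ^ 3)).const_add
      (3 * (x * Complex.I) ^ 2)).div (hc.pow 2) (by norm_num)).const_mul (a : ℂ)).sub
      ((tendsto_const_nhds (x := b * (x * Complex.I))).div hc one_ne_zero)
    have e : (a : ℂ) * ((3 * (x * Complex.I) ^ 2 + 2 * 0 * (x * Complex.I) ^ 3) / 1 ^ 2) -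
        b * (x * Complex.I) / 1 = -(3 * a) * (x : ℂ) ^ 2 + -(b * Complex.I) * x := by
      rw [mul_pow, Complex.I_sq]
      ring
    rw [e] at this
    exact this
  refine (hA.add hL).congr' ?_
  have htpos : ∀ᶠ n in atTop, 0 < t n := ht.eventually self_mem_nhdsWithin
  filter_upwards [hn, htpos] with n hn hpos
  have hne : (t n : ℂ) ≠ 0 := by exact_mod_cast hpos.ne'
  have hcn : c n ≠ 0 := by
    intro h
    have := congrArg Complex.re h
    simp [c] at this
  have hn' : (n : ℂ) = 2 * a / (t n : ℂ) ^ 3 := by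
    rw [eq_div_iff (pow_ne_zero _ hne)]
    exact_mod_cast hn
  have e : (t n : ℂ) + (t n ^ 2 * x : ℝ) * Complex.I = t n * c n := by
    simp only [c]
    push_cast
    ring
  rw [saddleExponent, e, ← h3, ← h2]
  push_cast
  rw [hn']
  generalize logGen (Complex.exp (-(↑(t n) * c n))) = L
  have hcdef : c n = 1 + t n * x * Complex.I := rfl
  have hw : (x * Complex.I : ℂ) = (c n - 1) / t n := by
    rw [hcdef]
    field_simp
    ring
  rw [hw]
  field_simp
  ring

open MeasureTheory in
lemma tendsto_integral_saddleExponent {a b : ℝ} (h3 : (a : ℂ) = 2 * riemannZeta 3)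
    (h2 : (b : ℂ) = riemannZeta 2) {t : ℕ → ℝ} (ht : Tendsto t atTop (𝓝[>] 0))
    (hn : ∀ᶠ n : ℕ in atTop, n * t n ^ 3 = 2 * a) :
    Tendsto (fun n => ∫ x in (-(π / t n ^ 2))..(π / t n ^ 2),
        Complex.exp (saddleExponent a b n (t n) x)) atTop
      (𝓝 (∫ x : ℝ, Complex.exp (-(3 * a) * (x : ℂ) ^ 2 + -(b * Complex.I) * x +
        ∫ u in Set.Ioi (0 : ℝ), rho u))) := by
  have ht0 : Tendsto t atTop (𝓝 0) := tendsto_nhds_of_tendsto_nhdsWithin ht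
  have htpos : ∀ᶠ n in atTop, 0 < t n := ht.eventually self_mem_nhdsWithin
  set C := ∫ u in Set.Ioi (0 : ℝ), rho u with hC
  let S : ℕ → Set ℝ := fun n => Set.Ioc (-(π / t n ^ 2)) (π / t n ^ 2)
  let F : ℕ → ℝ → ℂ := fun n => (S n).indicator fun x => Complex.exp (saddleExponent a b n (t n) x)
  let A : ℕ → ℝ := fun n => (logGen (Complex.exp (-(t n : ℂ)))).re -
    (a / t n ^ 2 + b / t n + 2 / 3 * Real.log (t n))
  have hA : Tendsto A atTop (𝓝 C.re) := by
    have h := (Complex.continuous_re.tendsto _).comp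
      (tendsto_logGen ht (tendsto_const_nhds (x := (1 : ℂ))))
    rw [← hC, ← h3, ← h2] at h
    refine h.congr (fun n => ?_)
    simp only [Function.comp, A, mul_one]
    have e : (a : ℂ) / (t n : ℂ) ^ 2 = ((a / t n ^ 2 : ℝ) : ℂ) := by push_cast; rfl
    have e' : (b : ℂ) / (t n : ℂ) = ((b / t n : ℝ) : ℂ) := by push_cast; rfl
    have e'' : (2 : ℂ) / 3 * (Real.log (t n) : ℂ) = ((2 / 3 * Real.log (t n) : ℝ) : ℂ) := by
      push_cast; rfl
    rw [e, e', e'', Complex.sub_re, Complex.sub_re, Complex.sub_re, Complex.ofReal_re,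
      Complex.ofReal_re, Complex.ofReal_re]
    ring
  have hmain : Tendsto (fun n => ∫ x, F n x) atTop
      (𝓝 (∫ x : ℝ, Complex.exp (-(3 * a) * (x : ℂ) ^ 2 + -(b * Complex.I) * x + C))) := by
    refine tendsto_integral_filter_of_dominated_convergence
      (fun x => Real.exp (C.re + 1) * (400 * (1 + x ^ 2)⁻¹)) ?_ ?_ ?_ ?_
    · filter_upwards [htpos] with n hpos
      refine (Measurable.indicator ?_ measurableSet_Ioc).aestronglyMeasurable
      simp only [saddleExponent]
      simp only [Complex.exp_sub, Complex.exp_add]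
      refine Measurable.div_const (Measurable.mul ?_ ?_) _
      · exact (measurable_exp_logGen hpos).comp (measurable_id.const_mul (t n ^ 2))
      · exact Continuous.measurable (by fun_prop)
    · filter_upwards [htpos, hA.eventually_le_const (lt_add_one _),
        ht0.eventually_le_const zero_lt_one] with n hpos hAn hn1
      refine Eventually.of_forall (fun x => ?_)
      by_cases hx : x ∈ S n
      · have hxb : t n ^ 2 * |x| ≤ π := by
          rw [mul_comm, ← le_div_iff₀ (by positivity)]
          exact abs_le.mpr ⟨hx.1.le, hx.2⟩
        simp only [F, Set.indicator_of_mem hx]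
        rw [Complex.norm_exp, re_saddleExponent, Real.exp_add, mul_comm]
        exact mul_le_mul (Real.exp_le_exp.mpr hAn) (exp_re_logGen_sub_le hpos hn1 hxb)
          (Real.exp_pos _).le (Real.exp_pos _).le
      · simp only [F, Set.indicator_of_notMem hx, norm_zero]
        positivity
    · exact (integrable_inv_one_add_sq.const_mul _).const_mul _
    · refine Eventually.of_forall (fun x => ?_)
      have hx : ∀ᶠ n in atTop, x ∈ S n := by
        have h1 : Tendsto (fun n => t n ^ 2 * |x|) atTop (𝓝 0) := by
          simpa using (ht0.pow 2).mul_const |x|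
        filter_upwards [htpos, h1.eventually_lt_const Real.pi_pos] with n hpos hlt
        have : |x| < π / t n ^ 2 := by
          rw [lt_div_iff₀ (by positivity), mul_comm]
          exact hlt
        exact ⟨(abs_lt.mp this).1, (abs_lt.mp this).2.le⟩
      have h := (Complex.continuous_exp.tendsto _).comp (tendsto_saddleExponent h3 h2 ht hn x)
      refine h.congr' ?_
      filter_upwards [hx] with n hxn
      simp only [F, Set.indicator_of_mem hxn, Function.comp]
  refine hmain.congr' ?_
  filter_upwards [htpos] with n hpos
  rw [integral_indicator measurableSet_Ioc, intervalIntegral.integral_of_le]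
  have : 0 < π / t n ^ 2 := by positivity
  linarith

lemma tendsto_pk_mul_exp {a b : ℝ} (h3 : (a : ℂ) = 2 * riemannZeta 3)
    (h2 : (b : ℂ) = riemannZeta 2) (ha : 0 < a) {t : ℕ → ℝ} (ht : Tendsto t atTop (𝓝[>] 0))
    (hn : ∀ᶠ n : ℕ in atTop, n * t n ^ 3 = 2 * a) :
    Tendsto (fun n : ℕ => 2 * π * pk (1 / 2) n / t n ^ 2 *
        Real.exp (-(a / t n ^ 2 + b / t n + 2 / 3 * Real.log (t n) + n * t n))) atTop
      (𝓝 ((π / (3 * a)) ^ (1 / 2 : ℝ) * Real.exp (2 * realZetaDeriv (-1) + realZetaDeriv 0 -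
        b ^ 2 / (12 * a)))) := by
  have hlim := (tendsto_integral_saddleExponent h3 h2 ht hn).norm
  have htpos : ∀ᶠ n in atTop, 0 < t n := ht.eventually self_mem_nhdsWithin
  have hb : (-(3 * a : ℂ)).re < 0 := by
    have : (-(3 * a : ℂ)) = ((-(3 * a) : ℝ) : ℂ) := by push_cast; rfl
    rw [this, Complex.ofReal_re]
    linarith
  rw [integral_cexp_quadratic hb, integral_rho] at hlim
  have e1 : ‖((π : ℂ) / -(-(3 * a : ℂ))) ^ (1 / 2 : ℂ)‖ = (π / (3 * a)) ^ (1 / 2 : ℝ) := by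
    have : (π : ℂ) / -(-(3 * a : ℂ)) = ((π / (3 * a) : ℝ) : ℂ) := by
      push_cast
      rw [neg_neg]
    rw [this, Complex.norm_cpow_eq_rpow_re_of_pos (by positivity)]
    norm_num
  have e2 : (2 * deriv riemannZeta (-1) + deriv riemannZeta 0 -
      (-(b * Complex.I)) ^ 2 / (4 * -(3 * a : ℂ))).re =
      2 * realZetaDeriv (-1) + realZetaDeriv 0 - b ^ 2 / (12 * a) := by
    have : (-(b * Complex.I)) ^ 2 / (4 * -(3 * a : ℂ)) = ((b ^ 2 / (12 * a) : ℝ) : ℂ) := by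
      rw [neg_sq, mul_pow, Complex.I_sq]
      have : (a : ℂ) ≠ 0 := by exact_mod_cast ha.ne'
      push_cast
      field_simp
      ring
    rw [this, Complex.sub_re, Complex.ofReal_re, Complex.add_re]
    simp [realZetaDeriv]
  rw [norm_mul, e1, Complex.norm_exp, e2] at hlim
  refine hlim.congr' ?_
  filter_upwards [htpos] with n hpos
  rw [integral_saddleExponent n hpos, Complex.norm_real, Real.norm_of_nonneg (by positivity)]

lemma hasSum_re_zeta {k : ℕ} (hk : 1 < k) :
    HasSum (fun m : ℕ => (1 / ((m : ℝ) + 1) ^ k : ℝ)) (riemannZeta k).re := by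
  refine (Complex.hasSum_re (hasSum_zeta hk)).congr_fun (fun m => ?_)
  have : 1 / ((m : ℂ) + 1) ^ k = ((1 / ((m : ℝ) + 1) ^ k : ℝ) : ℂ) := by
    push_cast
    rfl
  rw [this, Complex.ofReal_re]

lemma riemannZeta_natCast_eq_re {k : ℕ} (hk : 1 < k) :
    riemannZeta k = ((riemannZeta k).re : ℂ) := by
  refine (hasSum_zeta hk).unique ((Complex.hasSum_ofReal.mpr (hasSum_re_zeta hk)).congr_fun ?_)
  intro m
  push_cast
  rfl

lemma riemannZeta_natCast_re_pos {k : ℕ} (hk : 1 < k) : 0 < (riemannZeta k).re := by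
  have h := le_hasSum (hasSum_re_zeta hk) 0 (fun m _ => by positivity)
  norm_num at h
  linarith

lemma realZeta_three_pos : 0 < realZeta 3 := by
  simpa [realZeta] using riemannZeta_natCast_re_pos (k := 3) (by norm_num)

lemma ofReal_realZeta_three : (realZeta 3 : ℂ) = riemannZeta 3 := by
  simpa [realZeta] using (riemannZeta_natCast_eq_re (k := 3) (by norm_num)).symm

lemma ofReal_realZeta_two : (realZeta 2 : ℂ) = riemannZeta 2 := by
  simpa [realZeta] using (riemannZeta_natCast_eq_re (k := 2) (by norm_num)).symm

lemma saddle_exponent_eq {z w n t : ℝ} (hz : 0 < z) (hn : 0 < n)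
    (ht : t = (4 * z / n) ^ ((1 : ℝ) / 3)) :
    2 * z / t ^ 2 + w / t + n * t =
      (3 * z ^ ((1 : ℝ) / 3) / (2 : ℝ) ^ ((1 : ℝ) / 3)) * n ^ ((2 : ℝ) / 3) +
        (w / ((2 : ℝ) ^ ((2 : ℝ) / 3) * z ^ ((1 : ℝ) / 3))) * n ^ ((1 : ℝ) / 3) := by
  have cube : ∀ y : ℝ, 0 < y → (y ^ ((1 : ℝ) / 3)) ^ 3 = y := fun y hy => by
    rw [← Real.rpow_natCast, ← Real.rpow_mul hy.le]
    norm_num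
  have sq : ∀ y : ℝ, 0 < y → y ^ ((2 : ℝ) / 3) = (y ^ ((1 : ℝ) / 3)) ^ 2 := fun y hy => by
    rw [← Real.rpow_natCast, ← Real.rpow_mul hy.le]
    norm_num
  have h4 : (4 : ℝ) ^ ((1 : ℝ) / 3) = ((2 : ℝ) ^ ((1 : ℝ) / 3)) ^ 2 := by
    rw [← sq 2 two_pos, show (4 : ℝ) = 2 ^ (2 : ℝ) by norm_num, ← Real.rpow_mul (by norm_num)]
    norm_num
  rw [Real.div_rpow (by positivity) hn.le, Real.mul_rpow (by norm_num) hz.le, h4] at ht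
  rw [sq n hn, sq 2 two_pos]
  have hp := cube z hz
  have hq := cube 2 two_pos
  have hm := cube n hn
  have hp0 : 0 < z ^ ((1 : ℝ) / 3) := by positivity
  have hq0 : 0 < (2 : ℝ) ^ ((1 : ℝ) / 3) := by positivity
  have hm0 : 0 < n ^ ((1 : ℝ) / 3) := by positivity
  generalize z ^ ((1 : ℝ) / 3) = p at *
  generalize (2 : ℝ) ^ ((1 : ℝ) / 3) = q at *
  generalize n ^ ((1 : ℝ) / 3) = m at *
  rw [ht, ← hp, ← hm]
  have e : 2 * p ^ 3 / (q ^ 2 * p / m) ^ 2 = p * m ^ 2 / q := by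
    rw [← hq]
    field_simp
  have e' : m ^ 3 * (q ^ 2 * p / m) = 2 * (p * m ^ 2 / q) := by
    rw [← hq]
    field_simp
  rw [e, e']
  field_simp
  ring

lemma saddle_prefactor_eq {z n t : ℝ} (hz : 0 < z) (hn : 0 < n)
    (ht : t = (4 * z / n) ^ ((1 : ℝ) / 3)) :
    t ^ 2 / (2 * π) * Real.exp (2 / 3 * Real.log t) * (π / (3 * (2 * z))) ^ (1 / 2 : ℝ) =
      (2 : ℝ) ^ ((5 : ℝ) / 18) * (3 : ℝ) ^ (-(1 : ℝ) / 2) * π ^ (-(1 : ℝ) / 2) *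
        z ^ ((7 : ℝ) / 18) * n ^ (-(8 : ℝ) / 9) := by
  have hπ := Real.pi_pos
  have ht0 : 0 < t := by
    rw [ht]
    positivity
  have hlt : Real.log t = (2 * Real.log 2 + Real.log z - Real.log n) / 3 := by
    rw [ht, Real.log_rpow (by positivity), Real.log_div (by positivity) hn.ne',
      Real.log_mul (by norm_num) hz.ne', show (4 : ℝ) = 2 ^ 2 by norm_num, Real.log_pow]
    push_cast
    ring
  have hl : Real.log (π / (3 * (2 * z))) =
      Real.log π - (Real.log 3 + (Real.log 2 + Real.log z)) := by
    rw [Real.log_div hπ.ne' (by positivity), Real.log_mul (by norm_num) (by positivity),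
      Real.log_mul (by norm_num) hz.ne']
  have e1 : t ^ 2 / (2 * π) = Real.exp (2 * Real.log t - (Real.log 2 + Real.log π)) := by
    rw [Real.exp_sub, Real.exp_add, Real.exp_log two_pos, Real.exp_log hπ,
      show 2 * Real.log t = Real.log t + Real.log t by ring, Real.exp_add, Real.exp_log ht0, sq]
  rw [e1]
  simp only [Real.rpow_def_of_pos hz, Real.rpow_def_of_pos hn, Real.rpow_def_of_pos hπ,
    Real.rpow_def_of_pos two_pos, Real.rpow_def_of_pos three_pos,
    Real.rpow_def_of_pos (show 0 < π / (3 * (2 * z)) by positivity), hl, ← Real.exp_add, hlt]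
  congr 1
  ring

lemma tendsto_saddle_point {z : ℝ} (hz : 0 < z) :
    Tendsto (fun n : ℕ => (4 * z / n) ^ ((1 : ℝ) / 3)) atTop (𝓝[>] 0) := by
  refine tendsto_nhdsWithin_iff.mpr ⟨?_, ?_⟩
  · have h := (tendsto_const_div_atTop_nhds_zero_nat (4 * z)).rpow_const
      (p := (1 : ℝ) / 3) (Or.inr (by norm_num))
    simpa using h
  · filter_upwards [eventually_gt_atTop 0] with n hn
    have : (0 : ℝ) < n := by exact_mod_cast hn
    exact Set.mem_Ioi.mpr (by positivity)

lemma natCast_mul_saddle_point_pow {z : ℝ} (hz : 0 < z) :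
    ∀ᶠ n : ℕ in atTop, n * ((4 * z / n) ^ ((1 : ℝ) / 3)) ^ 3 = 2 * (2 * z) := by
  filter_upwards [eventually_gt_atTop 0] with n hn
  have : (0 : ℝ) < n := by exact_mod_cast hn
  rw [← Real.rpow_natCast, ← Real.rpow_mul (by positivity)]
  norm_num
  field_simp
  norm_num

end SqrtPartition

theorem stmt6 :
    Tendsto (fun n : ℕ => (pk (1 / 2) n : ℝ) /
        ((2 : ℝ) ^ ((5 : ℝ) / 18) * (3 : ℝ) ^ (-(1 : ℝ) / 2) * π ^ (-(1 : ℝ) / 2) *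
          (realZeta 3) ^ ((7 : ℝ) / 18) *
          Real.exp (2 * realZetaDeriv (-1) + realZetaDeriv 0) * (n : ℝ) ^ (-(8 : ℝ) / 9) *
          Real.exp ((3 * (realZeta 3) ^ ((1 : ℝ) / 3) / (2 : ℝ) ^ ((1 : ℝ) / 3)) *
              (n : ℝ) ^ ((2 : ℝ) / 3) +
            (realZeta 2 / ((2 : ℝ) ^ ((2 : ℝ) / 3) * (realZeta 3) ^ ((1 : ℝ) / 3))) *
              (n : ℝ) ^ ((1 : ℝ) / 3) -
            (realZeta 2) ^ 2 / (24 * realZeta 3))))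
      atTop (𝓝 1) := by
  open SqrtPartition in
  have hz := realZeta_three_pos
  have h := tendsto_pk_mul_exp (a := 2 * realZeta 3) (b := realZeta 2)
    (by rw [Complex.ofReal_mul, ofReal_realZeta_three, Complex.ofReal_ofNat])
    ofReal_realZeta_two (by positivity) (tendsto_saddle_point hz) (natCast_mul_saddle_point_pow hz)
  have hK : 0 < (π / (3 * (2 * realZeta 3))) ^ (1 / 2 : ℝ) *
      Real.exp (2 * realZetaDeriv (-1) + realZetaDeriv 0 -
        realZeta 2 ^ 2 / (12 * (2 * realZeta 3))) := by positivity
  have h1 := h.div_const ((π / (3 * (2 * realZeta 3))) ^ (1 / 2 : ℝ) *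
    Real.exp (2 * realZetaDeriv (-1) + realZetaDeriv 0 -
      realZeta 2 ^ 2 / (12 * (2 * realZeta 3))))
  rw [div_self hK.ne'] at h1
  refine h1.congr' ?_
  filter_upwards [eventually_gt_atTop 0] with n hn
  have hn' : (0 : ℝ) < n := by exact_mod_cast hn
  set t := (4 * realZeta 3 / n) ^ ((1 : ℝ) / 3) with ht
  have ht0 : 0 < t := by positivity
  have hE := saddle_exponent_eq (w := realZeta 2) hz hn' ht
  have hP := saddle_prefactor_eq hz hn' ht
  have e1 : -(2 * realZeta 3 / t ^ 2 + realZeta 2 / t + 2 / 3 * Real.log t + n * t) =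
      -(2 * realZeta 3 / t ^ 2 + realZeta 2 / t + n * t) - 2 / 3 * Real.log t := by ring
  rw [e1, hE]
  generalize (3 * (realZeta 3) ^ ((1 : ℝ) / 3) / (2 : ℝ) ^ ((1 : ℝ) / 3)) * (n : ℝ) ^ ((2 : ℝ) / 3) +
    (realZeta 2 / ((2 : ℝ) ^ ((2 : ℝ) / 3) * (realZeta 3) ^ ((1 : ℝ) / 3))) *
      (n : ℝ) ^ ((1 : ℝ) / 3) = E
  rw [mul_right_comm _ (Real.exp (2 * realZetaDeriv (-1) + realZetaDeriv 0)), ← hP]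
  rw [Real.exp_sub, Real.exp_neg, Real.exp_sub, Real.exp_sub,
    show 12 * (2 * realZeta 3) = 24 * realZeta 3 by ring]
  field_simp
end

section
/- As n → ∞, q_{1/2}(n) ~ 2^{−7/6}·3^{−1/3}·π^{−1/2}·ζ(3)^{1/6}·n^{−2/3} · exp( (3^{4/3}ζ(3)^{1/3}/2)·n^{2/3} + (ζ(2)/(2·3^{1/3}ζ(3)^{1/3}))·n^{1/3} − ζ(2)²/(72ζ(3)) ). -/
open Filter Topology Real

/-- `q_κ(n)`: number of partitions of `n` into distinct parts from `(⌊ℓ^κ⌋)_{ℓ ≥ 1}`. -/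
noncomputable def qk (κ : ℝ) (n : ℕ) : ℕ :=
  Nat.card {r : ℕ →₀ ℕ // (∀ ℓ, r ℓ ≤ 1) ∧ (r.sum fun ℓ j => j * psPart κ (ℓ + 1)) = n}

lemma psPart_one_half (ℓ : ℕ) : psPart (1 / 2) ℓ = Nat.sqrt ℓ := by
  rw [psPart, ← Real.sqrt_eq_rpow, Real.nat_floor_real_sqrt_eq_nat_sqrt]

lemma preimage_natSqrt (k : ℕ) :
    Nat.sqrt ⁻¹' {k} = ↑(Finset.Ico (k * k) ((k + 1) * (k + 1))) := by
  ext x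
  simp only [Set.mem_preimage, Set.mem_singleton_iff, Finset.coe_Ico, Set.mem_Ico]
  rw [eq_comm, Nat.eq_sqrt]

lemma tsum_preimage_natSqrt {𝕜 : Type*} [NormedField 𝕜] (r : 𝕜) (k : ℕ) :
    ∑' b : Nat.sqrt ⁻¹' {k}, r ^ Nat.sqrt b = (2 * k + 1) * r ^ k := by
  rw [preimage_natSqrt, Finset.tsum_subtype' _ (fun b => r ^ Nat.sqrt b)]
  have h : ∀ b ∈ Finset.Ico (k * k) ((k + 1) * (k + 1)), r ^ Nat.sqrt b = r ^ k := by
    intro b hb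
    rw [show Nat.sqrt b = k from (Nat.eq_sqrt.2 (by simpa using hb)).symm]
  rw [Finset.sum_congr rfl h, Finset.sum_const, Nat.card_Ico, nsmul_eq_mul,
    show (k + 1) * (k + 1) - k * k = 2 * k + 1 by
      rw [Nat.sub_eq_iff_eq_add (by nlinarith)]; ring]
  push_cast
  ring

lemma hasSum_odd_mul_geometric {𝕜 : Type*} [NormedField 𝕜] {r : 𝕜} (hr : ‖r‖ < 1) :
    HasSum (fun k : ℕ => (2 * (k : 𝕜) + 1) * r ^ k) (2 * (r / (1 - r) ^ 2) + (1 - r)⁻¹) := by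
  have h := ((hasSum_coe_mul_geometric_of_norm_lt_one hr).mul_left 2).add
    (hasSum_geometric_of_norm_lt_one hr)
  refine h.congr_fun ?_
  intro k
  ring

lemma summable_pow_natSqrt {𝕜 : Type*} [NormedField 𝕜] [CompleteSpace 𝕜] {r : 𝕜}
    (hr : ‖r‖ < 1) : Summable (fun ℓ : ℕ => r ^ Nat.sqrt ℓ) := by
  apply Summable.of_norm
  simp_rw [norm_pow]
  rw [← (Equiv.sigmaFiberEquiv Nat.sqrt).summable_iff, summable_sigma_of_nonneg]
  · constructor
    · intro k
      have : Finite {x // Nat.sqrt x = k} := by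
        refine Set.Finite.subset (Finset.finite_toSet _) (preimage_natSqrt k).subset
      exact Summable.of_finite
    · have : Summable (fun k : ℕ => (2 * (k : ℝ) + 1) * ‖r‖ ^ k) :=
        (hasSum_odd_mul_geometric (by simpa using hr)).summable
      refine this.congr fun k => ?_
      exact (tsum_preimage_natSqrt ‖r‖ k).symm
  · intro x
    simp only [Function.comp]
    positivity

lemma hasSum_pow_natSqrt_succ {𝕜 : Type*} [NormedField 𝕜] [CompleteSpace 𝕜] {r : 𝕜}
    (hr : ‖r‖ < 1) :
    HasSum (fun ℓ : ℕ => r ^ Nat.sqrt (ℓ + 1)) (2 * (r / (1 - r) ^ 2) + r / (1 - r)) := by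
  have hs := summable_pow_natSqrt hr
  have h := hs.hasSum.tsum_fiberwise Nat.sqrt
  simp_rw [tsum_preimage_natSqrt] at h
  have hr1 : 1 - r ≠ 0 := by
    intro h0
    rw [sub_eq_zero] at h0
    rw [← h0] at hr
    simp at hr
  rw [hasSum_nat_add_iff 1 (f := fun ℓ : ℕ => r ^ Nat.sqrt ℓ)]
  convert! hs.hasSum using 1
  rw [h.unique (hasSum_odd_mul_geometric hr)]
  simp only [Finset.range_one, Finset.sum_singleton, Nat.sqrt_zero, pow_zero]
  field_simp
  ring

lemma summable_log_series_uncurry {ι : Type*} {y : ι → ℂ} {ρ : ℝ} (hρ : ρ < 1)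
    (hy : ∀ i, ‖y i‖ ≤ ρ) (hs : Summable fun i => ‖y i‖) :
    Summable (Function.uncurry fun (m : ℕ) (i : ι) =>
      (-1 : ℂ) ^ m / (m + 1) * y i ^ (m + 1)) := by
  rcases isEmpty_or_nonempty ι with h | ⟨⟨i₀⟩⟩
  · exact summable_empty
  have hρ0 : 0 ≤ ρ := (norm_nonneg _).trans (hy i₀)
  refine Summable.of_norm_bounded (g := fun p : ℕ × ι => ρ ^ p.1 * ‖y p.2‖)
    ((summable_geometric_of_lt_one hρ0 hρ).mul_of_nonneg hs (fun m => by positivity)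
      (fun i => by positivity)) ?_
  rintro ⟨m, i⟩
  simp only [Function.uncurry, norm_mul, norm_div, norm_pow, norm_neg, norm_one, one_pow]
  have h1 : (1 : ℝ) / ‖(m : ℂ) + 1‖ ≤ 1 := by
    rw [show ((m : ℂ) + 1) = ((m + 1 : ℕ) : ℂ) by push_cast; ring, Complex.norm_natCast]
    rw [div_le_one (by positivity)]
    push_cast
    linarith [(Nat.cast_nonneg m : (0 : ℝ) ≤ m)]
  calc 1 / ‖(m : ℂ) + 1‖ * ‖y i‖ ^ (m + 1) ≤ 1 * (‖y i‖ ^ m * ‖y i‖) := by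
        rw [pow_succ]; gcongr
    _ ≤ ρ ^ m * ‖y i‖ := by
        rw [one_mul]
        gcongr
        exact hy i

lemma tprod_one_add_eq_exp {ι : Type*} {y : ι → ℂ} {ρ : ℝ} (hρ : ρ < 1)
    (hy : ∀ i, ‖y i‖ ≤ ρ) (hs : Summable fun i => ‖y i‖) :
    ∏' i, (1 + y i) =
      Complex.exp (∑' m : ℕ, (-1 : ℂ) ^ m / (m + 1) * ∑' i, y i ^ (m + 1)) := by
  have hsum := summable_log_series_uncurry hρ hy hs
  have hlog : ∀ i, HasSum (fun m : ℕ => (-1 : ℂ) ^ m / (m + 1) * y i ^ (m + 1))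
      (Complex.log (1 + y i)) := by
    intro i
    have h := Complex.hasSum_taylorSeries_log ((hy i).trans_lt hρ)
    rw [← hasSum_nat_add_iff' 1] at h
    simp only [Finset.range_one, Finset.sum_singleton, Nat.cast_zero, div_zero, sub_zero] at h
    refine h.congr_fun fun m => ?_
    push_cast
    ring
  have hne : ∀ i, 1 + y i ≠ 0 := by
    intro i h0
    have : y i = -1 := by linear_combination h0
    have h1 := (hy i).trans_lt hρ
    rw [this] at h1
    simp at h1
  have hcomm := hsum.tsum_comm
  have hswap : Summable fun i => Complex.log (1 + y i) := by
    refine (hsum.prod_symm.prod).congr fun i => ?_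
    exact (hlog i).tsum_eq
  rw [← Complex.cexp_tsum_eq_tprod hne hswap]
  congr 1
  simp_rw [← tsum_mul_left]
  rw [← hcomm]
  exact tsum_congr fun i => (hlog i).tsum_eq.symm

/-- The Dirichlet-type sum `∑ ℓ, exp (-w ⌊√(ℓ + 1)⌋)` in closed form. -/
noncomputable def sqrtExpSum (w : ℂ) : ℂ :=
  2 * (Complex.exp (-w) / (1 - Complex.exp (-w)) ^ 2) +
    Complex.exp (-w) / (1 - Complex.exp (-w))

/-- The generating function of `qk (1 / 2)` at `exp (-z)`. -/
noncomputable def sqrtGenFun (z : ℂ) : ℂ :=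
  ∏' ℓ : ℕ, (1 + Complex.exp (-z) ^ Nat.sqrt (ℓ + 1))

lemma norm_exp_neg_lt_one {z : ℂ} (hz : 0 < z.re) : ‖Complex.exp (-z)‖ < 1 := by
  rw [Complex.norm_exp, Real.exp_lt_one_iff]
  simpa using hz

lemma hasSum_sqrtExpSum {w : ℂ} (hw : 0 < w.re) :
    HasSum (fun ℓ : ℕ => Complex.exp (-w) ^ Nat.sqrt (ℓ + 1)) (sqrtExpSum w) :=
  hasSum_pow_natSqrt_succ (norm_exp_neg_lt_one hw)

lemma summable_norm_sqrtExp {w : ℂ} (hw : 0 < w.re) :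
    Summable (fun ℓ : ℕ => ‖Complex.exp (-w) ^ Nat.sqrt (ℓ + 1)‖) :=
  (hasSum_sqrtExpSum hw).summable.norm

lemma norm_sqrtExp_le {w : ℂ} (hw : 0 < w.re) (ℓ : ℕ) :
    ‖Complex.exp (-w) ^ Nat.sqrt (ℓ + 1)‖ ≤ ‖Complex.exp (-w)‖ := by
  rw [norm_pow]
  refine pow_le_of_le_one (norm_nonneg _) (norm_exp_neg_lt_one hw).le ?_
  rw [← Nat.pos_iff_ne_zero, Nat.sqrt_pos]
  omega

lemma tsum_sqrtExp_pow {z : ℂ} (hz : 0 < z.re) (m : ℕ) :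
    ∑' ℓ : ℕ, (Complex.exp (-z) ^ Nat.sqrt (ℓ + 1)) ^ (m + 1) = sqrtExpSum ((m + 1) * z) := by
  have hw : 0 < (((m : ℂ) + 1) * z).re := by
    rw [show ((m : ℂ) + 1) = (((m + 1 : ℕ) : ℝ) : ℂ) by push_cast; ring, Complex.re_ofReal_mul]
    positivity
  rw [← (hasSum_sqrtExpSum hw).tsum_eq]
  refine tsum_congr fun ℓ => ?_
  rw [← pow_mul, mul_comm, pow_mul, ← Complex.exp_nat_mul]
  congr 2
  push_cast
  ring

lemma sqrtGenFun_eq_exp {z : ℂ} (hz : 0 < z.re) :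
    sqrtGenFun z =
      Complex.exp (∑' m : ℕ, (-1 : ℂ) ^ m / (m + 1) * sqrtExpSum ((m + 1) * z)) := by
  rw [sqrtGenFun, tprod_one_add_eq_exp (norm_exp_neg_lt_one hz) (norm_sqrtExp_le hz)
    (summable_norm_sqrtExp hz)]
  simp_rw [tsum_sqrtExp_pow hz]

lemma summable_log_sqrtGenFun {z : ℂ} (hz : 0 < z.re) :
    Summable fun m : ℕ => (-1 : ℂ) ^ m / (m + 1) * sqrtExpSum ((m + 1) * z) := by
  have h := (summable_log_series_uncurry (norm_exp_neg_lt_one hz) (norm_sqrtExp_le hz)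
    (summable_norm_sqrtExp hz)).prod
  refine h.congr fun m => ?_
  rw [← tsum_sqrtExp_pow hz, ← tsum_mul_left]
  rfl

/-- `sqrtExpSum` with its polar part at `0` removed. -/
noncomputable def sqrtExpReg (w : ℂ) : ℂ := sqrtExpSum w - 2 / w ^ 2 - 1 / w

lemma tendsto_exp_taylor_three :
    Tendsto (fun w : ℂ => (Complex.exp w - 1 - w - w ^ 2 / 2 - w ^ 3 / 6) / w ^ 3)
      (𝓝[≠] 0) (𝓝 0) := by
  have h0 : Tendsto (fun w : ℂ => ‖w‖) (𝓝[≠] 0) (𝓝 0) := by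
    have : Tendsto (fun w : ℂ => ‖w‖) (𝓝 0) (𝓝 0) := by
      simpa using (continuous_norm (E := ℂ)).tendsto 0
    exact this.mono_left nhdsWithin_le_nhds
  refine squeeze_zero_norm' ?_ h0
  filter_upwards [self_mem_nhdsWithin, h0.eventually_le_const zero_lt_one] with w hw hw1
  have hb := Complex.exp_bound hw1 (n := 4) (by norm_num)
  simp only [Finset.sum_range_succ, Finset.sum_range_zero, Nat.factorial] at hb
  have hwp : 0 < ‖w‖ := norm_pos_iff.2 hw
  rw [norm_div, norm_pow, div_le_iff₀ (by positivity)]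
  calc ‖Complex.exp w - 1 - w - w ^ 2 / 2 - w ^ 3 / 6‖ = _ := by
        congr 1
        push_cast
        ring
    _ ≤ _ := hb
    _ ≤ ‖w‖ ^ 4 * 1 := by
        gcongr
        norm_num
    _ = ‖w‖ * ‖w‖ ^ 3 := by ring

lemma tendsto_sqrtExpReg_zero : Tendsto sqrtExpReg (𝓝[≠] 0) (𝓝 (-2 / 3)) := by
  have hq := tendsto_exp_taylor_three
  set q : ℂ → ℂ := fun w => (Complex.exp w - 1 - w - w ^ 2 / 2 - w ^ 3 / 6) / w ^ 3 with hqd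
  have hw : Tendsto (fun w : ℂ => w) (𝓝[≠] 0) (𝓝 0) := tendsto_id.mono_left nhdsWithin_le_nhds
  have hh : Tendsto (fun w => 1 / 6 + q w) (𝓝[≠] 0) (𝓝 (1 / 6 + 0)) := hq.const_add _
  set h : ℂ → ℂ := fun w => 1 / 6 + q w with hhd
  have hp : Tendsto (fun w => 1 + w / 2 + w ^ 2 * h w) (𝓝[≠] 0)
      (𝓝 (1 + 0 / 2 + 0 ^ 2 * (1 / 6 + 0))) :=
    ((hw.div_const 2).const_add 1).add ((hw.pow 2).mul hh)
  have hnum : Tendsto (fun w => -4 * h w + w * (-h w - 1 / 4) + w ^ 2 * (-2 * h w ^ 2 - h w)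
      - w ^ 3 * h w ^ 2) (𝓝[≠] 0) (𝓝 (-4 * (1 / 6 + 0) + 0 * (-(1 / 6 + 0) - 1 / 4)
        + 0 ^ 2 * (-2 * (1 / 6 + 0) ^ 2 - (1 / 6 + 0)) - 0 ^ 3 * (1 / 6 + 0) ^ 2)) :=
    (((hh.const_mul _).add (hw.mul (hh.neg.sub_const _))).add
      ((hw.pow 2).mul (((hh.pow 2).const_mul _).sub hh))).sub ((hw.pow 3).mul (hh.pow 2))
  have hdiv := hnum.div (hp.pow 2) (by norm_num)
  have hp0 := hp.eventually (isOpen_ne.mem_nhds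
    (show (1 + 0 / 2 + 0 ^ 2 * (1 / 6 + 0) : ℂ) ≠ 0 by norm_num))
  have hlim : ((-4 * (1 / 6 + 0) + 0 * (-(1 / 6 + 0) - 1 / 4)
        + 0 ^ 2 * (-2 * (1 / 6 + 0) ^ 2 - (1 / 6 + 0)) - 0 ^ 3 * (1 / 6 + 0) ^ 2) /
      (1 + 0 / 2 + 0 ^ 2 * (1 / 6 + 0)) ^ 2 : ℂ) = -2 / 3 := by norm_num
  rw [hlim] at hdiv
  refine hdiv.congr' ?_
  filter_upwards [self_mem_nhdsWithin, hp0] with w hw0 hpw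
  have hw0 : w ≠ 0 := hw0
  simp only [Pi.div_apply]
  have hE : Complex.exp w = 1 + w * (1 + w / 2 + w ^ 2 * h w) := by
    simp only [hhd, hqd]
    field_simp
    ring
  have hE0 : Complex.exp w ≠ 0 := Complex.exp_ne_zero w
  set e := Complex.exp w
  have he1 : e - 1 ≠ 0 := by
    rw [hE]
    simpa using ⟨hw0, hpw⟩
  have h1 : sqrtExpReg w = ((3 * (e - 1) + 2) * w ^ 2 - (2 + w) * (e - 1) ^ 2) /
      (w ^ 2 * (e - 1) ^ 2) := by
    simp only [sqrtExpReg, sqrtExpSum, Complex.exp_neg]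
    have h2 : 1 - e⁻¹ = (e - 1) / e := by field_simp
    change 2 * (e⁻¹ / (1 - e⁻¹) ^ 2) + e⁻¹ / (1 - e⁻¹) - 2 / w ^ 2 - 1 / w = _
    rw [h2]
    field_simp
    ring
  set H := h w
  rw [h1, hE, div_eq_div_iff (by positivity) (by
    have : 1 + w * (1 + w / 2 + w ^ 2 * H) - 1 ≠ 0 := by rw [← hE]; exact he1
    positivity)]
  ring

lemma one_sub_exp_neg_ne_zero {w : ℂ} (hw : 0 < w.re) : 1 - Complex.exp (-w) ≠ 0 := by
  intro h
  have h1 := norm_exp_neg_lt_one hw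
  rw [← sub_eq_zero.1 h] at h1
  simp at h1

lemma ne_zero_of_re_pos {w : ℂ} (hw : 0 < w.re) : w ≠ 0 := by
  rintro rfl
  simp at hw

lemma differentiableAt_sqrtExpReg {w : ℂ} (hw : 0 < w.re) :
    DifferentiableAt ℂ sqrtExpReg w := by
  have h1 := one_sub_exp_neg_ne_zero hw
  have h0 := ne_zero_of_re_pos hw
  unfold sqrtExpReg sqrtExpSum
  have he : DifferentiableAt ℂ (fun w => Complex.exp (-w)) w := by fun_prop
  refine DifferentiableAt.sub (DifferentiableAt.sub (DifferentiableAt.add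
    (DifferentiableAt.const_mul (he.div ((he.const_sub 1).pow 2) (pow_ne_zero 2 h1)) 2)
    (he.div (he.const_sub 1) h1)) ?_) ?_
  · exact (differentiableAt_const _).div (differentiableAt_id.pow 2) (pow_ne_zero 2 h0)
  · exact (differentiableAt_const _).div differentiableAt_id h0

lemma exists_bound_sqrtExpReg :
    ∃ C : ℝ, 0 ≤ C ∧ ∀ w : ℂ, w ≠ 0 → ‖w‖ / 4 ≤ w.re → ‖sqrtExpReg w‖ ≤ C := by
  have h1 : ∀ᶠ w in 𝓝[≠] (0 : ℂ), ‖sqrtExpReg w‖ ≤ 1 :=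
    tendsto_sqrtExpReg_zero.norm.eventually_le_const (by norm_num)
  rw [eventually_nhdsWithin_iff, Metric.eventually_nhds_iff] at h1
  obtain ⟨δ, hδ, h1⟩ := h1
  set ρ := Real.exp (-(δ / 4)) with hρ
  have hρ1 : 0 < 1 - ρ := by
    rw [sub_pos, hρ, Real.exp_lt_one_iff]
    linarith
  refine ⟨max 1 (2 * (1 / (1 - ρ) ^ 2) + 1 / (1 - ρ) + 2 / δ ^ 2 + 1 / δ),
    le_max_of_le_left zero_le_one, fun w hw0 hw => ?_⟩
  rcases lt_or_ge ‖w‖ δ with hlt | hge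
  · exact (h1 (by simpa using hlt) hw0).trans (le_max_left _ _)
  · refine le_trans ?_ (le_max_right _ _)
    have hre : δ / 4 ≤ w.re := by linarith
    have hr : ‖Complex.exp (-w)‖ ≤ ρ := by
      rw [Complex.norm_exp, hρ]
      gcongr
      simpa using hre
    have hr1 : ‖Complex.exp (-w)‖ ≤ 1 := by linarith
    have hden : 1 - ρ ≤ ‖1 - Complex.exp (-w)‖ := by
      have := norm_sub_norm_le (1 : ℂ) (Complex.exp (-w))
      rw [norm_one] at this
      linarith
    unfold sqrtExpReg sqrtExpSum
    refine (norm_sub_le _ _).trans (add_le_add ((norm_sub_le _ _).trans (add_le_add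
      ((norm_add_le _ _).trans (add_le_add ?_ ?_)) ?_)) ?_)
    · rw [norm_mul, norm_div, norm_pow, Complex.norm_ofNat]
      gcongr
    · rw [norm_div]
      gcongr
    · rw [norm_div, norm_pow, Complex.norm_ofNat]
      gcongr
    · rw [norm_div, norm_one]
      gcongr

lemma exists_bound_deriv_sqrtExpReg :
    ∃ C : ℝ, 0 ≤ C ∧ ∀ w : ℂ, w ≠ 0 → ‖w‖ / 2 ≤ w.re →
      ‖deriv sqrtExpReg w‖ ≤ C / ‖w‖ := by
  obtain ⟨C, hC0, hC⟩ := exists_bound_sqrtExpReg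
  refine ⟨8 * C, by positivity, fun w hw0 hw => ?_⟩
  have hwp : 0 < ‖w‖ := norm_pos_iff.2 hw0
  have key : ∀ v ∈ Metric.closedBall w (‖w‖ / 8), 0 < v.re ∧ ‖v‖ / 4 ≤ v.re := by
    intro v hv
    rw [Metric.mem_closedBall, dist_eq_norm] at hv
    have h1 : |(v - w).re| ≤ ‖v - w‖ := Complex.abs_re_le_norm _
    rw [Complex.sub_re] at h1
    have h2 := neg_le_of_abs_le h1
    have h3 : ‖v‖ ≤ ‖w‖ + ‖v - w‖ := by
      simpa using norm_add_le w (v - w)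
    constructor <;> linarith
  have hd : DiffContOnCl ℂ sqrtExpReg (Metric.ball w (‖w‖ / 8)) := by
    apply DifferentiableOn.diffContOnCl
    rw [closure_ball _ (by positivity)]
    exact fun v hv => (differentiableAt_sqrtExpReg (key v hv).1).differentiableWithinAt
  have := Complex.norm_deriv_le_of_forall_mem_sphere_norm_le (by positivity) hd
    (C := C) (fun v hv => by
      have hk := key v (Metric.sphere_subset_closedBall hv)
      exact hC v (ne_zero_of_re_pos hk.1) hk.2)
  refine this.trans_eq ?_
  field_simp

lemma exists_bound_sqrtExpReg_sub :
    ∃ C : ℝ, 0 ≤ C ∧ ∀ z : ℂ, z ≠ 0 → ‖z‖ / 2 ≤ z.re → ∀ j : ℝ, 0 < j →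
      ‖sqrtExpReg (j * z) - sqrtExpReg ((j + 1) * z)‖ ≤ C / j := by
  obtain ⟨C, hC0, hC⟩ := exists_bound_deriv_sqrtExpReg
  refine ⟨C, hC0, fun z hz0 hz j hj => ?_⟩
  have hzp : 0 < ‖z‖ := norm_pos_iff.2 hz0
  have key : ∀ v ∈ segment ℝ ((j : ℂ) * z) ((j + 1) * z),
      0 < v.re ∧ ‖v‖ / 2 ≤ v.re ∧ j * ‖z‖ ≤ ‖v‖ := by
    rintro v ⟨a, b, ha, hb, hab, rfl⟩
    have hv : a • ((j : ℂ) * z) + b • (((j : ℂ) + 1) * z) = ((j + b : ℝ) : ℂ) * z := by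
      simp only [Complex.real_smul]
      have : (a : ℂ) = 1 - b := by rw [← Complex.ofReal_one, ← hab]; push_cast; ring
      rw [this]
      push_cast
      ring
    rw [hv, Complex.re_ofReal_mul, norm_mul, Complex.norm_real, Real.norm_of_nonneg (by positivity)]
    have hjb : 0 < j + b := by positivity
    refine ⟨mul_pos hjb (by linarith), ?_, ?_⟩
    · rw [mul_div_assoc]
      gcongr
    · gcongr
      linarith
  have := (convex_segment ((j : ℂ) * z) ((j + 1) * z)).norm_image_sub_le_of_norm_deriv_le
    (𝕜 := ℂ) (f := sqrtExpReg) (C := C / (j * ‖z‖))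
    (fun v hv => differentiableAt_sqrtExpReg (key v hv).1)
    (fun v hv => by
      obtain ⟨h1, h2, h3⟩ := key v hv
      refine (hC v (ne_zero_of_re_pos h1) h2).trans ?_
      gcongr)
    (left_mem_segment ℝ _ _) (right_mem_segment ℝ _ _)
  rw [norm_sub_rev]
  refine this.trans_eq ?_
  rw [show ((j : ℂ) + 1) * z - j * z = z by ring]
  field_simp

lemma hasSum_realZeta {k : ℕ} (hk : 1 < k) :
    HasSum (fun m : ℕ => 1 / ((m : ℝ) + 1) ^ k) (realZeta k) := by
  have hs : Summable (fun n : ℕ => 1 / (n : ℝ) ^ k) := Real.summable_one_div_nat_pow.2 hk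
  have h0 : realZeta k = ∑' n : ℕ, 1 / (n : ℝ) ^ k := by
    rw [realZeta, Complex.ofReal_natCast, zeta_nat_eq_tsum_of_gt_one hk, ← Complex.ofReal_re
      (∑' n : ℕ, 1 / (n : ℝ) ^ k), Complex.ofReal_tsum]
    push_cast
    rfl
  have h1 := hs.hasSum
  rw [← h0, ← hasSum_nat_add_iff' 1] at h1
  have hk0 : k ≠ 0 := by omega
  simpa [hk0] using h1

lemma hasSum_alternating_realZeta {k : ℕ} (hk : 1 < k) :
    HasSum (fun m : ℕ => (-1 : ℝ) ^ m / ((m : ℝ) + 1) ^ k) ((1 - 2 / 2 ^ k) * realZeta k) := by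
  have h := hasSum_realZeta hk
  have hodd : HasSum (fun j : ℕ => 1 / (((2 * j + 1 : ℕ) : ℝ) + 1) ^ k) (realZeta k / 2 ^ k) := by
    refine (h.div_const (2 ^ k)).congr_fun fun j => ?_
    rw [div_div, ← mul_pow]
    push_cast
    ring_nf
  obtain ⟨e, heven⟩ : ∃ e, HasSum (fun j : ℕ => 1 / (((2 * j : ℕ) : ℝ) + 1) ^ k) e :=
    h.summable.comp_injective (i := fun j : ℕ => 2 * j) (fun a b hab => by simpa using hab)
  have htot := (HasSum.even_add_odd (f := fun m : ℕ => 1 / ((m : ℝ) + 1) ^ k) heven hodd).unique h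
  have halt := HasSum.even_add_odd (f := fun m : ℕ => (-1 : ℝ) ^ m / ((m : ℝ) + 1) ^ k)
    (heven.congr_fun fun j => by rw [pow_mul]; norm_num)
    (hodd.neg.congr_fun fun j => by rw [pow_succ, pow_mul]; norm_num; ring)
  rw [show (1 - 2 / 2 ^ k) * realZeta k = e + -(realZeta k / 2 ^ k) by
    linear_combination -htot]
  exact halt

lemma hasSum_log_two :
    HasSum (fun j : ℕ => 1 / (2 * (j : ℝ) + 1) - 1 / (2 * j + 2)) (Real.log 2) := by
  rw [hasSum_iff_tendsto_nat_of_nonneg]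
  swap
  · intro j
    rw [sub_nonneg]
    gcongr
    norm_num
  have hsum : ∀ n : ℕ, ∑ j ∈ Finset.range n, (1 / (2 * (j : ℝ) + 1) - 1 / (2 * j + 2)) =
      (harmonic (2 * n) : ℝ) - harmonic n := by
    intro n
    induction n with
    | zero => simp
    | succ n ih =>
      rw [Finset.sum_range_succ, ih, show 2 * (n + 1) = 2 * n + 1 + 1 by ring, harmonic_succ,
        harmonic_succ, harmonic_succ]
      push_cast
      field_simp
      ring
  simp_rw [hsum]
  have h1 := Real.tendsto_harmonic_sub_log
  have h2 := h1.comp (tendsto_id.const_mul_atTop' (r := 2) two_pos)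
  have h3 := (h2.sub h1).add_const (Real.log 2)
  rw [sub_self, zero_add] at h3
  refine h3.congr' ?_
  filter_upwards [eventually_gt_atTop 0] with n hn
  have : (n : ℝ) ≠ 0 := by positivity
  simp only [Function.comp, id]
  push_cast
  rw [Real.log_mul (by norm_num) this]
  ring

/-- The sector in which the generating function is expanded. -/
def halfSector : Set ℂ := {z | z ≠ 0 ∧ ‖z‖ / 2 ≤ z.re}

lemma re_pos_of_mem_halfSector {z : ℂ} (hz : z ∈ halfSector) : 0 < z.re :=
  lt_of_lt_of_le (half_pos (norm_pos_iff.2 hz.1)) hz.2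

lemma real_mul_mem_halfSector {z : ℂ} (hz : z ∈ halfSector) {a : ℝ} (ha : 0 < a) :
    (a : ℂ) * z ∈ halfSector := by
  refine ⟨mul_ne_zero (by exact_mod_cast ha.ne') hz.1, ?_⟩
  rw [norm_mul, Complex.norm_real, Real.norm_of_nonneg ha.le, Complex.re_ofReal_mul, mul_div_assoc]
  exact mul_le_mul_of_nonneg_left hz.2 ha.le

/-- Consecutive terms, paired, of the regular part of `log (sqrtGenFun z)`. -/
noncomputable def regPair (j : ℕ) (z : ℂ) : ℂ :=
  sqrtExpReg (((2 * j + 1 : ℝ) : ℂ) * z) / (2 * j + 1) -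
    sqrtExpReg (((2 * j + 2 : ℝ) : ℂ) * z) / (2 * j + 2)

lemma tendsto_tsum_regPair :
    Tendsto (fun z => ∑' j, regPair j z) (𝓝[halfSector] 0)
      (𝓝 ((-(2 / 3) * Real.log 2 : ℝ) : ℂ)) := by
  obtain ⟨C₁, hC₁, h₁⟩ := exists_bound_sqrtExpReg
  obtain ⟨C₂, hC₂, h₂⟩ := exists_bound_sqrtExpReg_sub
  have hlog := hasSum_log_two
  have hlim : ((-(2 / 3) * Real.log 2 : ℝ) : ℂ) =
      ∑' j : ℕ, ((-(2 / 3) * (1 / (2 * (j : ℝ) + 1) - 1 / (2 * j + 2)) : ℝ) : ℂ) := by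
    rw [← Complex.ofReal_tsum, (hlog.mul_left _).tsum_eq]
  rw [hlim]
  have hsq : Summable fun j : ℕ => C₂ / (2 * (j : ℝ) + 1) ^ 2 := by
    have hs := (hasSum_realZeta (k := 2) (by norm_num)).summable.comp_injective
      (i := fun j : ℕ => 2 * j) (fun a b hab => by simpa using hab)
    refine (hs.mul_left C₂).congr fun j => ?_
    simp only [Function.comp]
    push_cast
    ring
  refine tendsto_tsum_of_dominated_convergence
    (bound := fun j : ℕ => C₂ / (2 * (j : ℝ) + 1) ^ 2 +
      C₁ * (1 / (2 * (j : ℝ) + 1) - 1 / (2 * j + 2)))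
    (hsq.add (hlog.summable.mul_left C₁)) ?_ ?_
  · intro j
    have hg : ∀ a : ℝ, 0 < a → Tendsto (fun z : ℂ => sqrtExpReg ((a : ℂ) * z))
        (𝓝[halfSector] 0) (𝓝 (-2 / 3)) := by
      intro a ha
      refine tendsto_sqrtExpReg_zero.comp (tendsto_nhdsWithin_iff.2 ⟨?_, ?_⟩)
      · have : Tendsto (fun z : ℂ => (a : ℂ) * z) (𝓝 0) (𝓝 (a * 0)) :=
          tendsto_id.const_mul _
        rw [mul_zero] at this
        exact this.mono_left nhdsWithin_le_nhds
      · filter_upwards [self_mem_nhdsWithin] with z hz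
        exact (real_mul_mem_halfSector hz ha).1
    have := ((hg (2 * j + 1) (by positivity)).div_const (2 * j + 1)).sub
      ((hg (2 * j + 2) (by positivity)).div_const (2 * j + 2))
    convert! this using 2
    push_cast
    ring
  · filter_upwards [self_mem_nhdsWithin] with z hz j
    have hj1 : (2 * (j : ℂ) + 1) ≠ 0 := by exact_mod_cast (by positivity : (2 * (j : ℝ) + 1) ≠ 0)
    have hj2 : (2 * (j : ℂ) + 2) ≠ 0 := by exact_mod_cast (by positivity : (2 * (j : ℝ) + 2) ≠ 0)
    have hnn : 0 ≤ 1 / (2 * (j : ℝ) + 1) - 1 / (2 * j + 2) := by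
      rw [sub_nonneg]
      gcongr
      norm_num
    have hdec : regPair j z = (sqrtExpReg (((2 * j + 1 : ℝ) : ℂ) * z) -
        sqrtExpReg ((((2 * j + 1 : ℝ) : ℂ) + 1) * z)) / ((2 * j + 1 : ℝ) : ℂ) +
        sqrtExpReg (((2 * j + 2 : ℝ) : ℂ) * z) *
          ((1 / (2 * (j : ℝ) + 1) - 1 / (2 * j + 2) : ℝ) : ℂ) := by
      have : (((2 * j + 1 : ℝ) : ℂ) + 1) = ((2 * j + 2 : ℝ) : ℂ) := by push_cast; ring
      rw [regPair, this]
      push_cast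
      field_simp
      ring
    rw [hdec]
    refine (norm_add_le _ _).trans (add_le_add ?_ ?_)
    · rw [norm_div, Complex.norm_real, Real.norm_of_nonneg (by positivity : (0 : ℝ) ≤ 2 * j + 1),
        pow_two, ← div_div]
      gcongr
      exact h₂ z hz.1 hz.2 _ (by positivity)
    · rw [norm_mul, Complex.norm_real, Real.norm_of_nonneg hnn]
      gcongr
      have := real_mul_mem_halfSector hz (a := 2 * j + 2) (by positivity)
      refine h₁ _ this.1 (le_trans ?_ this.2)
      linarith [norm_nonneg (((2 * j + 2 : ℝ) : ℂ) * z)]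

/-- The polar part of `log (sqrtGenFun z)` at `0`. -/
noncomputable def polarPart (z : ℂ) : ℂ :=
  ((3 / 2 * realZeta 3 : ℝ) : ℂ) / z ^ 2 + ((realZeta 2 / 2 : ℝ) : ℂ) / z

lemma sqrtGenFun_eq_exp_polarPart {z : ℂ} (hz : z ∈ halfSector) :
    sqrtGenFun z = Complex.exp (polarPart z + ∑' j, regPair j z) := by
  have hre := re_pos_of_mem_halfSector hz
  have hz0 := hz.1
  have hφ := (summable_log_sqrtGenFun hre).hasSum
  have h3 := (Complex.hasSum_ofReal.2 (hasSum_alternating_realZeta (k := 3) (by norm_num))).mul_left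
    (2 / z ^ 2)
  have h2 := (Complex.hasSum_ofReal.2 (hasSum_alternating_realZeta (k := 2) (by norm_num))).mul_left
    (1 / z)
  have hg := (hφ.sub h3).sub h2
  have hg' : HasSum (fun m : ℕ => (-1 : ℂ) ^ m / (m + 1) * sqrtExpReg ((m + 1) * z))
      (∑' m : ℕ, (-1 : ℂ) ^ m / (m + 1) * sqrtExpSum ((m + 1) * z) -
        2 / z ^ 2 * (((1 - 2 / 2 ^ 3) * realZeta (3 : ℕ) : ℝ) : ℂ) -
        1 / z * (((1 - 2 / 2 ^ 2) * realZeta (2 : ℕ) : ℝ) : ℂ)) := by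
    refine hg.congr_fun fun m => ?_
    have hm : (m : ℂ) + 1 ≠ 0 := by exact_mod_cast m.succ_ne_zero
    rw [sqrtExpReg]
    push_cast
    field_simp
  set f : ℕ → ℂ := fun m => (-1 : ℂ) ^ m / (m + 1) * sqrtExpReg ((m + 1) * z) with hf
  obtain ⟨e, he⟩ : ∃ e, HasSum (fun j : ℕ => f (2 * j)) e :=
    hg'.summable.comp_injective (i := fun j : ℕ => 2 * j) (fun a b hab => by simpa using hab)
  obtain ⟨o, ho⟩ : ∃ o, HasSum (fun j : ℕ => f (2 * j + 1)) o :=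
    hg'.summable.comp_injective (i := fun j : ℕ => 2 * j + 1)
      (fun a b hab => by simpa using hab)
  have hpair : ∑' j, regPair j z = e + o := by
    refine ((he.add ho).congr_fun fun j => ?_).tsum_eq
    have h1 : f (2 * j) = sqrtExpReg (((2 * j + 1 : ℝ) : ℂ) * z) / (2 * j + 1) := by
      simp only [hf, pow_mul]
      push_cast
      ring
    have h2 : f (2 * j + 1) = -(sqrtExpReg (((2 * j + 2 : ℝ) : ℂ) * z) / (2 * j + 2)) := by
      simp only [hf, pow_succ, pow_mul]
      push_cast
      ring_nf
    rw [h1, h2, regPair, sub_eq_add_neg]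
  have htot := (he.even_add_odd ho).unique hg'
  rw [sqrtGenFun_eq_exp hre, hpair, htot, polarPart]
  congr 1
  push_cast
  ring

lemma tendsto_sqrtGenFun_mul_exp_polarPart :
    Tendsto (fun z => sqrtGenFun z * Complex.exp (-polarPart z)) (𝓝[halfSector] 0)
      (𝓝 (((2 : ℝ) ^ (-(2 / 3) : ℝ) : ℝ) : ℂ)) := by
  have h := (Complex.continuous_exp.tendsto _).comp tendsto_tsum_regPair
  rw [← Complex.ofReal_exp, mul_comm, ← Real.rpow_def_of_pos two_pos] at h
  refine h.congr' ?_
  filter_upwards [self_mem_nhdsWithin] with z hz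
  rw [sqrtGenFun_eq_exp_polarPart hz, ← Complex.exp_add]
  simp

lemma qk_one_half_eq_card (n : ℕ) :
    qk (1 / 2) n = Nat.card {s : Finset ℕ // ∑ ℓ ∈ s, Nat.sqrt (ℓ + 1) = n} := by
  have hsum : ∀ r : ℕ →₀ ℕ, (∀ ℓ, r ℓ ≤ 1) →
      (r.sum fun ℓ j => j * psPart (1 / 2) (ℓ + 1)) = ∑ ℓ ∈ r.support, Nat.sqrt (ℓ + 1) := by
    intro r hr
    refine Finset.sum_congr rfl fun ℓ hℓ => ?_
    have h1 : r ℓ = 1 := le_antisymm (hr ℓ) (Nat.pos_of_ne_zero (Finsupp.mem_support_iff.1 hℓ))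
    simp only [psPart_one_half, h1, one_mul]
  rw [qk]
  refine Nat.card_congr
    { toFun := fun r => ⟨r.1.support, by rw [← hsum r.1 r.2.1]; exact r.2.2⟩
      invFun := fun s => ⟨Finsupp.indicator s.1 fun _ _ => 1, ?_⟩
      left_inv := ?_
      right_inv := ?_ }
  · have hr : ∀ ℓ, Finsupp.indicator s.1 (fun _ _ => 1) ℓ ≤ 1 := by
      intro ℓ
      rw [Finsupp.indicator_apply]
      split_ifs <;> simp
    refine ⟨hr, ?_⟩
    rw [hsum _ hr]
    convert s.2
    ext ℓ
    simp [Finsupp.indicator_apply]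
  · rintro ⟨r, hr, hn⟩
    ext ℓ
    simp only [Finsupp.indicator_apply, Finsupp.mem_support_iff]
    have := hr ℓ
    split_ifs <;> omega
  · rintro ⟨s, hs⟩
    ext ℓ
    simp [Finsupp.indicator_apply]

lemma integral_exp_int_mul_I (k : ℤ) :
    ∫ θ in (-π)..π, Complex.exp (k * Complex.I * θ) = if k = 0 then 2 * (π : ℂ) else 0 := by
  split_ifs with hk
  · subst hk
    simp
    ring
  · have hc : (k : ℂ) * Complex.I ≠ 0 := mul_ne_zero (by exact_mod_cast hk) Complex.I_ne_zero
    rw [integral_exp_mul_complex hc, div_eq_zero_iff]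
    left
    rw [sub_eq_zero, Complex.exp_eq_exp_iff_exists_int]
    refine ⟨k, ?_⟩
    push_cast
    ring

lemma tsum_exp_pow_eq_sqrtGenFun {z : ℂ} (hz : 0 < z.re) :
    ∑' s : Finset ℕ, Complex.exp (-z) ^ (∑ ℓ ∈ s, Nat.sqrt (ℓ + 1)) = sqrtGenFun z := by
  rw [sqrtGenFun, tprod_one_add (summable_finsetProd_of_summable_norm (summable_norm_sqrtExp hz))]
  simp_rw [Finset.prod_pow_eq_pow_sum]

lemma integral_sqrtGenFun {t : ℝ} (ht : 0 < t) (n : ℕ) :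
    ∫ θ in (-π)..π, sqrtGenFun (t - θ * Complex.I) * Complex.exp (-(n * θ * Complex.I)) =
      2 * π * Real.exp (-(n * t)) * qk (1 / 2) n := by
  set N : Finset ℕ → ℕ := fun s => ∑ ℓ ∈ s, Nat.sqrt (ℓ + 1) with hN
  set F : Finset ℕ → ℝ → ℂ := fun s θ =>
    Complex.exp (-(t - θ * Complex.I)) ^ N s * Complex.exp (-(n * θ * Complex.I)) with hF
  have hF1 : ∀ s θ, F s θ = Real.exp (-t) ^ N s *
      Complex.exp (((N s - n : ℤ) : ℂ) * Complex.I * θ) := by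
    intro s θ
    simp only [hF]
    push_cast
    rw [← Complex.exp_nat_mul, ← Complex.exp_nat_mul, ← Complex.exp_add, ← Complex.exp_add]
    congr 1
    ring
  have hnorm : ∀ s θ, ‖F s θ‖ = Real.exp (-t) ^ N s := by
    intro s θ
    rw [hF1, norm_mul, norm_pow, Complex.norm_real, Real.norm_of_nonneg (Real.exp_pos _).le,
      show ((N s - n : ℤ) : ℂ) * Complex.I * θ = (((N s - n : ℤ) * θ : ℝ) : ℂ) * Complex.I by
        push_cast; ring, Complex.norm_exp_ofReal_mul_I, mul_one]
  have hsum : Summable fun s => Real.exp (-t) ^ N s := by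
    have h1 : ‖Real.exp (-t)‖ < 1 := by
      rw [Real.norm_of_nonneg (Real.exp_pos _).le, Real.exp_lt_one_iff]
      linarith
    have h := summable_finsetProd_of_summable_norm (hasSum_pow_natSqrt_succ h1).summable.norm
    refine h.congr fun s => ?_
    rw [Finset.prod_pow_eq_pow_sum]
  have hint := MeasureTheory.hasSum_integral_of_summable_integral_norm (F := F)
    (μ := MeasureTheory.volume.restrict (Set.Ioc (-π) π))
    (fun s => by
      have hc : Continuous (F s) := by
        simp only [hF]
        fun_prop
      exact (hc.intervalIntegrable (-π) π).1)
    (by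
      simp_rw [hnorm]
      simp only [MeasureTheory.integral_const, smul_eq_mul]
      exact hsum.mul_left _)
  have hval : ∀ s, ∫ θ in Set.Ioc (-π) π, F s θ =
      {s | N s = n}.indicator (fun _ => 2 * (π : ℂ) * Real.exp (-(n * t))) s := by
    intro s
    rw [← intervalIntegral.integral_of_le (by linarith [pi_pos])]
    simp_rw [hF1]
    rw [intervalIntegral.integral_const_mul, integral_exp_int_mul_I]
    by_cases h : N s = n
    · rw [Set.indicator_of_mem (by exact h), if_pos (by rw [h, sub_self]), h]
      rw [← Complex.ofReal_pow, ← Real.exp_nat_mul, mul_neg]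
      ring
    · rw [Set.indicator_of_notMem (by exact h), if_neg (by rw [sub_eq_zero]; exact_mod_cast h),
        mul_zero]
  simp_rw [hval] at hint
  have h2 := hint.tsum_eq
  rw [← tsum_subtype, tsum_const, nsmul_eq_mul, ← intervalIntegral.integral_of_le
    (by linarith [pi_pos])] at h2
  rw [qk_one_half_eq_card, mul_comm (2 * (π : ℂ) * Real.exp (-(n * t)))]
  refine Eq.trans ?_ h2.symm
  refine intervalIntegral.integral_congr fun θ _ => ?_
  simp only [hF, hN]
  rw [tsum_mul_right, tsum_exp_pow_eq_sqrtGenFun (by simpa using ht)]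

lemma norm_one_add_le {z : ℂ} (hz : ‖z‖ ≤ 1) :
    ‖1 + z‖ ≤ (1 + ‖z‖) * Real.exp (-(‖z‖ - z.re) / 4) := by
  have hd : 0 ≤ ‖z‖ - z.re := sub_nonneg.2 (Complex.re_le_norm z)
  refine le_of_sq_le_sq ?_ (by positivity)
  have h1 : ‖1 + z‖ ^ 2 = (1 + ‖z‖) ^ 2 - 2 * (‖z‖ - z.re) := by
    have := Complex.sq_norm z
    rw [Complex.normSq_apply] at this
    rw [Complex.sq_norm, Complex.normSq_apply]
    simp only [Complex.add_re, Complex.one_re, Complex.add_im, Complex.one_im, zero_add]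
    linear_combination -this
  have h2 : (1 + ‖z‖) ^ 2 ≤ 4 := by nlinarith [norm_nonneg z]
  have h3 := Real.add_one_le_exp (-(‖z‖ - z.re) / 2)
  rw [mul_pow, ← Real.exp_nat_mul, h1]
  calc (1 + ‖z‖) ^ 2 - 2 * (‖z‖ - z.re) ≤ (1 + ‖z‖) ^ 2 * (-(‖z‖ - z.re) / 2 + 1) := by
        nlinarith
    _ ≤ (1 + ‖z‖) ^ 2 * Real.exp (-(‖z‖ - z.re) / 2) := by gcongr
    _ = _ := by
        congr 2
        push_cast
        ring

lemma norm_tprod_one_add_le {ι : Type*} {y : ι → ℂ} (hs : Summable fun i => ‖y i‖)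
    (hy : ∀ i, ‖y i‖ ≤ 1) :
    ‖∏' i, (1 + y i)‖ ≤ ‖∏' i, (1 + (‖y i‖ : ℂ))‖ *
      Real.exp (-(∑' i, ‖y i‖ - (∑' i, y i).re) / 4) := by
  have h1 : Tendsto (fun s : Finset ι => ‖∏ i ∈ s, (1 + y i)‖) atTop
      (𝓝 ‖∏' i, (1 + y i)‖) :=
    Filter.Tendsto.norm (multipliable_one_add_of_summable hs).hasProd
  have hs' : Summable fun i => ‖(‖y i‖ : ℂ)‖ := by simpa using hs
  have h2 : Tendsto (fun s : Finset ι => ‖∏ i ∈ s, (1 + (‖y i‖ : ℂ))‖) atTop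
      (𝓝 ‖∏' i, (1 + (‖y i‖ : ℂ))‖) :=
    Filter.Tendsto.norm (multipliable_one_add_of_summable hs').hasProd
  have h3 : Tendsto (fun s : Finset ι => ∑ i ∈ s, (‖y i‖ - (y i).re)) atTop
      (𝓝 (∑' i, ‖y i‖ - (∑' i, y i).re)) := by
    have := hs.hasSum.sub (Complex.hasSum_re hs.of_norm.hasSum)
    exact this
  have h4 := h2.mul ((Real.continuous_exp.tendsto _).comp (h3.neg.div_const 4))
  refine le_of_tendsto_of_tendsto' h1 h4 fun s => ?_
  simp only [Function.comp, norm_prod]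
  rw [← Finset.sum_neg_distrib, Finset.sum_div, Real.exp_sum, ← Finset.prod_mul_distrib]
  refine Finset.prod_le_prod (fun i _ => norm_nonneg _) fun i _ => ?_
  refine (norm_one_add_le (hy i)).trans_eq ?_
  rw [← Complex.ofReal_one, ← Complex.ofReal_add, Complex.norm_real,
    Real.norm_of_nonneg (by positivity)]

lemma ofReal_norm_sqrtExp (z : ℂ) (ℓ : ℕ) :
    ((‖Complex.exp (-z) ^ Nat.sqrt (ℓ + 1)‖ : ℝ) : ℂ) =
      Complex.exp (-(z.re : ℂ)) ^ Nat.sqrt (ℓ + 1) := by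
  rw [norm_pow, Complex.norm_exp]
  push_cast
  simp

lemma norm_sqrtGenFun_le {z : ℂ} (hz : 0 < z.re) :
    ‖sqrtGenFun z‖ ≤ ‖sqrtGenFun z.re‖ *
      Real.exp (-((sqrtExpSum z.re).re - (sqrtExpSum z).re) / 4) := by
  have h := norm_tprod_one_add_le (summable_norm_sqrtExp hz)
    (fun ℓ => (norm_sqrtExp_le hz ℓ).trans (norm_exp_neg_lt_one hz).le)
  have h1 : ∑' ℓ : ℕ, ‖Complex.exp (-z) ^ Nat.sqrt (ℓ + 1)‖ = (sqrtExpSum z.re).re := by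
    rw [← Complex.ofReal_re (∑' ℓ : ℕ, ‖Complex.exp (-z) ^ Nat.sqrt (ℓ + 1)‖), Complex.ofReal_tsum]
    simp_rw [ofReal_norm_sqrtExp]
    rw [(hasSum_sqrtExpSum (by simpa using hz)).tsum_eq]
  rw [h1, (hasSum_sqrtExpSum hz).tsum_eq] at h
  simp_rw [ofReal_norm_sqrtExp] at h
  exact h

lemma sqrtExpSum_re_sub_ge {t θ : ℝ} (ht : 0 < t) (ht1 : t ≤ 1) (hθ : |θ| ≤ π) :
    4 / 45 * (θ ^ 2 / (t ^ 2 * (t ^ 2 + θ ^ 2))) ≤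
      (sqrtExpSum t).re - (sqrtExpSum (t - θ * Complex.I)).re := by
  set x := Real.exp (-t) with hx
  set r := Complex.exp (-((t : ℂ) - θ * Complex.I)) with hr
  have hx0 : 0 < x := Real.exp_pos _
  have hx1 : x < 1 := by rw [hx, Real.exp_lt_one_iff]; linarith
  have hxt : 1 - x ≤ t := by linarith [Real.add_one_le_exp (-t)]
  have hx3 : 1 / 3 ≤ x := by
    have h1 : Real.exp (-1) ≤ x := Real.exp_le_exp.2 (by linarith)
    refine le_trans ?_ h1
    rw [Real.exp_neg, one_div]
    exact inv_anti₀ (Real.exp_pos 1) Real.exp_one_lt_three.le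
  have hrx : ‖r‖ = x := by rw [hr, Complex.norm_exp]; simp [hx]
  have hrre : r.re = x * Real.cos θ := by rw [hr, Complex.exp_re]; simp [hx]
  have hv1 : 1 - Real.cos θ ≤ θ ^ 2 / 2 := by linarith [Real.one_sub_sq_div_two_le_cos (x := θ)]
  have hv2 : θ ^ 2 / 5 ≤ 1 - Real.cos θ := by
    have h1 := Real.cos_le_one_sub_mul_cos_sq hθ
    have h2 : 1 / 5 ≤ 2 / π ^ 2 := by
      rw [div_le_div_iff₀ (by norm_num) (by positivity)]
      nlinarith [Real.pi_lt_d2, Real.pi_pos]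
    nlinarith [sq_nonneg θ]
  have hv0 : 0 ≤ 1 - Real.cos θ := by linarith [Real.cos_le_one θ]
  have hD : ‖1 - r‖ ^ 2 = (1 - x) ^ 2 + 2 * x * (1 - Real.cos θ) := by
    have h1 : ‖r‖ ^ 2 = _ := Complex.sq_norm r
    rw [Complex.normSq_apply, hrx] at h1
    rw [Complex.sq_norm, Complex.normSq_apply]
    simp only [Complex.sub_re, Complex.one_re, Complex.sub_im, Complex.one_im, zero_sub]
    linear_combination -h1 - 2 * hrre
  have hDa : 1 - x ≤ ‖1 - r‖ := by
    have := norm_sub_norm_le (1 : ℂ) r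
    rwa [norm_one, hrx] at this
  have ha : 0 < 1 - x := by linarith
  have hDpos : 0 < ‖1 - r‖ := by linarith
  have hDle : ‖1 - r‖ ^ 2 ≤ t ^ 2 + θ ^ 2 := by
    rw [hD]
    nlinarith
  have hmain : (sqrtExpSum t).re = 2 * (x / (1 - x) ^ 2) + x / (1 - x) := by
    have : sqrtExpSum t = ((2 * (x / (1 - x) ^ 2) + x / (1 - x) : ℝ) : ℂ) := by
      rw [sqrtExpSum, hx]
      push_cast
      rfl
    rw [this, Complex.ofReal_re]
  have hother : (sqrtExpSum (t - θ * Complex.I)).re ≤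
      2 * (x / ‖1 - r‖ ^ 2) + x / (1 - x) := by
    refine (Complex.re_le_norm _).trans ?_
    rw [sqrtExpSum]
    refine (norm_add_le _ _).trans (add_le_add ?_ ?_)
    · rw [norm_mul, norm_div, norm_pow, Complex.norm_ofNat, hrx]
    · rw [norm_div, hrx]
      gcongr
  have hdiff : 2 * (x / (1 - x) ^ 2) - 2 * (x / ‖1 - r‖ ^ 2) =
      4 * x ^ 2 * (1 - Real.cos θ) / ((1 - x) ^ 2 * ‖1 - r‖ ^ 2) := by
    field_simp
    rw [hD]
    ring
  calc 4 / 45 * (θ ^ 2 / (t ^ 2 * (t ^ 2 + θ ^ 2)))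
      = 4 * (1 / 3) ^ 2 * (θ ^ 2 / 5) / (t ^ 2 * (t ^ 2 + θ ^ 2)) := by ring
    _ ≤ 4 * x ^ 2 * (1 - Real.cos θ) / ((1 - x) ^ 2 * ‖1 - r‖ ^ 2) := by gcongr
    _ ≤ _ := by rw [← hdiff]; linarith

lemma measurable_sqrtGenFun_line {t : ℝ} (ht : 0 < t) :
    Measurable fun θ : ℝ => sqrtGenFun (t - θ * Complex.I) := by
  refine measurable_of_tendsto_metrizable (f := fun (k : ℕ) (θ : ℝ) => ∏ ℓ ∈ Finset.range k,
    (1 + Complex.exp (-(t - θ * Complex.I)) ^ Nat.sqrt (ℓ + 1))) (fun k => ?_) ?_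
  · exact Continuous.measurable (by fun_prop)
  · rw [tendsto_pi_nhds]
    intro θ
    exact (multipliable_one_add_of_summable
      (summable_norm_sqrtExp (by simpa using ht))).hasProd.tendsto_prod_nat

lemma exp_neg_sq_div_le (u : ℝ) :
    Real.exp (-(u ^ 2 / (45 * (1 + 4 * |u|)))) ≤ 200000 * (1 + u ^ 2)⁻¹ := by
  have hu := abs_nonneg u
  have h1 : |u| / 180 - 1 / 720 ≤ u ^ 2 / (45 * (1 + 4 * |u|)) := by
    rw [le_div_iff₀ (by positivity), ← sq_abs u]
    nlinarith
  have h2 : Real.exp (1 / 720) ≤ 3 := by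
    refine le_trans (Real.exp_le_exp.2 (by norm_num)) Real.exp_one_lt_three.le
  have h3 : (1 + u ^ 2) / 64800 ≤ Real.exp (|u| / 180) := by
    refine le_trans ?_ (Real.quadratic_le_exp_of_nonneg (by positivity))
    rw [← sq_abs u]
    nlinarith
  calc Real.exp (-(u ^ 2 / (45 * (1 + 4 * |u|)))) ≤ Real.exp (1 / 720 + -(|u| / 180)) := by
        gcongr
        linarith
    _ = Real.exp (1 / 720) * (Real.exp (|u| / 180))⁻¹ := by rw [Real.exp_add, Real.exp_neg]
    _ ≤ 3 * ((1 + u ^ 2) / 64800)⁻¹ := by gcongr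
    _ ≤ 200000 * (1 + u ^ 2)⁻¹ := by
        rw [inv_div, div_eq_mul_inv, ← mul_assoc]
        gcongr
        norm_num

lemma norm_sqrtGenFun_line_le {t u : ℝ} (ht : 0 < t) (ht1 : t ≤ 1) (hu : |t ^ 2 * u| ≤ π) :
    ‖sqrtGenFun (t - (t ^ 2 * u : ℝ) * Complex.I)‖ ≤
      ‖sqrtGenFun t‖ * (200000 * (1 + u ^ 2)⁻¹) := by
  have hre : ((t : ℂ) - (t ^ 2 * u : ℝ) * Complex.I).re = t := by
    simp [-Complex.ofReal_mul, -Complex.ofReal_pow]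
  have h := norm_sqrtGenFun_le (z := (t : ℂ) - (t ^ 2 * u : ℝ) * Complex.I) (by rw [hre]; exact ht)
  rw [hre] at h
  refine h.trans ?_
  gcongr
  refine le_trans ?_ (exp_neg_sq_div_le u)
  rw [Real.exp_le_exp]
  have h1 := sqrtExpSum_re_sub_ge ht ht1 hu
  have h2 : (t ^ 2 * u) ^ 2 / (t ^ 2 * (t ^ 2 + (t ^ 2 * u) ^ 2)) =
      u ^ 2 / (1 + t ^ 2 * u ^ 2) := by
    field_simp
  have h3 : t ^ 2 * u ^ 2 ≤ 4 * |u| := by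
    rw [abs_mul, abs_of_nonneg (by positivity : 0 ≤ t ^ 2)] at hu
    rw [← sq_abs u]
    nlinarith [abs_nonneg u, Real.pi_le_four]
  have h4 : u ^ 2 / (1 + 4 * |u|) ≤ u ^ 2 / (1 + t ^ 2 * u ^ 2) := by gcongr
  have h5 : u ^ 2 / (45 * (1 + 4 * |u|)) = u ^ 2 / (1 + 4 * |u|) / 45 := by
    rw [div_div, mul_comm]
  rw [h2] at h1
  rw [h5]
  linarith

lemma polarPart_line_sub {t u : ℝ} (ht : 0 < t) {n : ℕ} (hn : n * t ^ 3 = 3 * realZeta 3) :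
    polarPart (t - (t ^ 2 * u : ℝ) * Complex.I) - polarPart t - n * (t ^ 2 * u : ℝ) * Complex.I =
      ((3 / 2 * realZeta 3 : ℝ) : ℂ) * (-3 * u ^ 2 - 2 * t * (u * Complex.I) ^ 3) /
          (1 - t * (u * Complex.I)) ^ 2 +
        ((realZeta 2 / 2 : ℝ) : ℂ) * (u * Complex.I) / (1 - t * (u * Complex.I)) := by
  have ht0 : (t : ℂ) ≠ 0 := by exact_mod_cast ht.ne'
  have hn' : (n : ℂ) = 3 * realZeta 3 / t ^ 3 := by
    rw [eq_div_iff (pow_ne_zero 3 ht0)]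
    exact_mod_cast hn
  have h1 : (1 : ℂ) - t * (u * Complex.I) ≠ 0 := by
    intro h
    have := congrArg Complex.re h
    simp at this
  have hI : (u : ℂ) ^ 2 = -(u * Complex.I) ^ 2 := by rw [mul_pow, Complex.I_sq]; ring
  have hz : (t : ℂ) - (t ^ 2 * u : ℝ) * Complex.I = t * (1 - t * (u * Complex.I)) := by
    push_cast
    ring
  have h2 : (n : ℂ) * (t ^ 2 * u : ℝ) * Complex.I = 3 * realZeta 3 / t * (u * Complex.I) := by
    rw [hn']
    push_cast
    field_simp
  rw [hz, h2, hI, polarPart, polarPart]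
  push_cast
  generalize (u : ℂ) * Complex.I = s at *
  field_simp
  ring

lemma tendsto_line_halfSector {t : ℕ → ℝ} (ht : ∀ᶠ n in atTop, 0 < t n)
    (ht0 : Tendsto t atTop (𝓝 0)) (u : ℝ) :
    Tendsto (fun n => (t n : ℂ) - (t n ^ 2 * u : ℝ) * Complex.I) atTop (𝓝[halfSector] 0) := by
  refine tendsto_nhdsWithin_iff.2 ⟨?_, ?_⟩
  · have h1 : Tendsto (fun n => t n ^ 2 * u) atTop (𝓝 (0 ^ 2 * u)) := (ht0.pow 2).mul_const u
    have h2 := ((Complex.continuous_ofReal.tendsto _).comp ht0).sub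
      (((Complex.continuous_ofReal.tendsto _).comp h1).mul_const Complex.I)
    simpa using h2
  · have h1 : Tendsto (fun n => t n * |u|) atTop (𝓝 (0 * |u|)) := ht0.mul_const _
    rw [zero_mul] at h1
    filter_upwards [ht, h1.eventually_le_const zero_lt_one] with n hn hn1
    have hre : ((t n : ℂ) - (t n ^ 2 * u : ℝ) * Complex.I).re = t n := by
      simp [-Complex.ofReal_mul, -Complex.ofReal_pow]
    refine ⟨ne_zero_of_re_pos (by rw [hre]; exact hn), ?_⟩
    rw [hre]
    have h2 : ‖(t n : ℂ) - (t n ^ 2 * u : ℝ) * Complex.I‖ ≤ t n + t n * (t n * |u|) := by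
      refine (norm_sub_le _ _).trans_eq ?_
      rw [norm_mul, Complex.norm_I, mul_one, Complex.norm_real, Complex.norm_real,
        Real.norm_of_nonneg hn.le, Real.norm_eq_abs, abs_mul, abs_of_nonneg (by positivity)]
      ring
    nlinarith

lemma tendsto_integrand {t : ℕ → ℝ} (ht : ∀ᶠ n in atTop, 0 < t n)
    (ht0 : Tendsto t atTop (𝓝 0)) (hn : ∀ᶠ n : ℕ in atTop, n * t n ^ 3 = 3 * realZeta 3) (u : ℝ) :
    Tendsto (fun n : ℕ => sqrtGenFun (t n - (t n ^ 2 * u : ℝ) * Complex.I) *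
        Complex.exp (-(n * (t n ^ 2 * u : ℝ) * Complex.I)) * Complex.exp (-polarPart (t n))) atTop
      (𝓝 (((2 : ℝ) ^ (-(2 / 3) : ℝ) : ℝ) *
        Complex.exp (-(9 / 2 * realZeta 3 : ℝ) * u ^ 2 + (realZeta 2 / 2 : ℝ) * Complex.I * u
          + 0))) := by
  have h1 := tendsto_sqrtGenFun_mul_exp_polarPart.comp (tendsto_line_halfSector ht ht0 u)
  have htc : Tendsto (fun n => (t n : ℂ)) atTop (𝓝 0) :=
    (Complex.continuous_ofReal.tendsto _).comp ht0
  have hcont : ContinuousAt (fun s : ℂ =>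
      Complex.exp (((3 / 2 * realZeta 3 : ℝ) : ℂ) * (-3 * u ^ 2 - 2 * s * (u * Complex.I) ^ 3) /
          (1 - s * (u * Complex.I)) ^ 2 +
        ((realZeta 2 / 2 : ℝ) : ℂ) * (u * Complex.I) / (1 - s * (u * Complex.I)))) 0 := by
    fun_prop (disch := simp)
  have h2 := hcont.tendsto.comp htc
  convert! (h1.mul h2).congr' ?_ using 2
  · congr 2
    push_cast
    simp
    ring
  · filter_upwards [ht, hn] with n hn1 hn2
    simp only [Function.comp]
    rw [← polarPart_line_sub hn1 hn2, mul_assoc (sqrtGenFun _), mul_assoc (sqrtGenFun _),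
      ← Complex.exp_add, ← Complex.exp_add]
    congr 2
    ring

lemma integral_sqrtGenFun_scaled {t : ℝ} (ht : 0 < t) (n : ℕ) :
    ∫ u, (Set.Ioc (-(π / t ^ 2)) (π / t ^ 2)).indicator
      (fun u : ℝ => sqrtGenFun (t - (t ^ 2 * u : ℝ) * Complex.I) *
        Complex.exp (-(n * (t ^ 2 * u : ℝ) * Complex.I)) * Complex.exp (-polarPart t)) u =
    2 * π * (qk (1 / 2) n / (t ^ 2 * Real.exp (n * t)) * Complex.exp (-polarPart t)) := by
  have hpos : 0 < π / t ^ 2 := by positivity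
  rw [MeasureTheory.integral_indicator measurableSet_Ioc,
    ← intervalIntegral.integral_of_le (by linarith), intervalIntegral.integral_mul_const,
    intervalIntegral.integral_comp_mul_left (fun θ : ℝ => sqrtGenFun (t - θ * Complex.I) *
      Complex.exp (-(n * θ * Complex.I))) (by positivity : t ^ 2 ≠ 0)]
  have h1 : t ^ 2 * (π / t ^ 2) = π := by field_simp
  rw [mul_neg, h1, integral_sqrtGenFun ht, Complex.real_smul, Real.exp_neg]
  push_cast
  field_simp

lemma realZeta_three_pos : 0 < realZeta 3 := by
  have h := hasSum_realZeta (k := 3) (by norm_num)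
  have := h.summable.tsum_pos (fun m => by positivity) 0 (by norm_num)
  rw [h.tsum_eq] at this
  exact_mod_cast this

lemma tendsto_integral_scaled {t : ℕ → ℝ} (ht : ∀ᶠ n in atTop, 0 < t n)
    (ht0 : Tendsto t atTop (𝓝 0)) (hn : ∀ᶠ n : ℕ in atTop, n * t n ^ 3 = 3 * realZeta 3) :
    Tendsto (fun n : ℕ => ∫ u, (Set.Ioc (-(π / t n ^ 2)) (π / t n ^ 2)).indicator
      (fun u : ℝ => sqrtGenFun (t n - (t n ^ 2 * u : ℝ) * Complex.I) *
        Complex.exp (-(n * (t n ^ 2 * u : ℝ) * Complex.I)) * Complex.exp (-polarPart (t n))) u)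
      atTop (𝓝 (∫ u : ℝ, ((2 : ℝ) ^ (-(2 / 3) : ℝ) : ℝ) *
        Complex.exp (-(9 / 2 * realZeta 3 : ℝ) * u ^ 2 + (realZeta 2 / 2 : ℝ) * Complex.I * u
          + 0))) := by
  have hK : (2 : ℝ) ^ (-(2 / 3) : ℝ) < 1 :=
    Real.rpow_lt_one_of_one_lt_of_neg (by norm_num) (by norm_num)
  have hbd : ∀ᶠ n in atTop, ‖sqrtGenFun (t n) * Complex.exp (-polarPart (t n))‖ ≤ 1 := by
    have h1 := (tendsto_sqrtGenFun_mul_exp_polarPart.comp (tendsto_line_halfSector ht ht0 0)).norm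
    rw [Complex.norm_real, Real.norm_of_nonneg (by positivity)] at h1
    filter_upwards [h1.eventually_le_const hK] with n hn
    simpa using hn
  refine MeasureTheory.tendsto_integral_filter_of_dominated_convergence
    (fun u => 200000 * (1 + u ^ 2)⁻¹) ?_ ?_ (integrable_inv_one_add_sq.const_mul _) ?_
  · filter_upwards [ht] with n hn
    refine (Measurable.indicator ?_ measurableSet_Ioc).aestronglyMeasurable
    refine Measurable.mul_const (Measurable.mul ?_ (Continuous.measurable (by fun_prop))) _
    exact (measurable_sqrtGenFun_line hn).comp (measurable_const_mul (t n ^ 2))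
  · filter_upwards [ht, ht0.eventually_le_const zero_lt_one, hbd] with n hn hn1 hb
    refine Eventually.of_forall fun u => ?_
    by_cases hu : u ∈ Set.Ioc (-(π / t n ^ 2)) (π / t n ^ 2)
    · rw [Set.indicator_of_mem hu]
      have hu' : |t n ^ 2 * u| ≤ π := by
        have h2 : |u| ≤ π / t n ^ 2 := abs_le.2 ⟨hu.1.le, hu.2⟩
        rw [abs_mul, abs_of_nonneg (by positivity), mul_comm]
        rwa [le_div_iff₀ (by positivity)] at h2
      have h3 : ‖Complex.exp (-(n * (t n ^ 2 * u : ℝ) * Complex.I))‖ = 1 := by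
        rw [Complex.norm_exp]
        simp [-Complex.ofReal_mul, -Complex.ofReal_pow]
      rw [norm_mul, norm_mul, h3, mul_one]
      rw [norm_mul] at hb
      calc _ ≤ ‖sqrtGenFun (t n)‖ * (200000 * (1 + u ^ 2)⁻¹) *
              ‖Complex.exp (-polarPart (t n))‖ := by
            gcongr
            exact norm_sqrtGenFun_line_le hn hn1 hu'
        _ = (‖sqrtGenFun (t n)‖ * ‖Complex.exp (-polarPart (t n))‖) *
              (200000 * (1 + u ^ 2)⁻¹) := by ring
        _ ≤ 1 * (200000 * (1 + u ^ 2)⁻¹) := by gcongr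
        _ = _ := one_mul _
    · rw [Set.indicator_of_notMem hu, norm_zero]
      positivity
  · refine Eventually.of_forall fun u => ?_
    refine (tendsto_integrand ht ht0 hn u).congr' ?_
    have h1 : Tendsto (fun n => t n ^ 2 * |u|) atTop (𝓝 (0 ^ 2 * |u|)) := (ht0.pow 2).mul_const _
    rw [zero_pow two_ne_zero, zero_mul] at h1
    filter_upwards [ht, h1.eventually_lt_const pi_pos] with n hn hn1
    rw [Set.indicator_of_mem]
    have h2 : |u| < π / t n ^ 2 := by
      rw [lt_div_iff₀ (by positivity)]
      linarith
    exact ⟨(abs_lt.1 h2).1, (abs_lt.1 h2).2.le⟩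

lemma tendsto_qk_one_half {t : ℕ → ℝ} (ht : ∀ᶠ n in atTop, 0 < t n)
    (ht0 : Tendsto t atTop (𝓝 0)) (hn : ∀ᶠ n : ℕ in atTop, n * t n ^ 3 = 3 * realZeta 3) :
    Tendsto (fun n : ℕ => (qk (1 / 2) n : ℝ) / (t n ^ 2 *
        Real.exp (n * t n + 3 / 2 * realZeta 3 / t n ^ 2 + realZeta 2 / 2 / t n)))
      atTop (𝓝 ((2 : ℝ) ^ (-(2 / 3) : ℝ) / (2 * π) * (π / (9 / 2 * realZeta 3)) ^ (1 / 2 : ℝ) *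
        Real.exp (-(realZeta 2 ^ 2 / (72 * realZeta 3))))) := by
  have hZ := realZeta_three_pos
  have h := tendsto_integral_scaled ht ht0 hn
  rw [MeasureTheory.integral_const_mul, integral_cexp_quadratic (by
    rw [← Complex.ofReal_neg, Complex.ofReal_re]; linarith)] at h
  have h2 := (h.congr' (ht.mono fun n hn => integral_sqrtGenFun_scaled hn n)).const_mul
    (1 / (2 * (π : ℂ)))
  have h3 := (Complex.continuous_re.tendsto _).comp h2
  convert! h3.congr' ?_ using 2
  · rw [neg_neg, ← Complex.ofReal_div, show (1 / 2 : ℂ) = ((1 / 2 : ℝ) : ℂ) by push_cast; rfl,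
      ← Complex.ofReal_cpow (by positivity)]
    rw [show (0 - ((realZeta 2 / 2 : ℝ) * Complex.I) ^ 2 / (4 * -((9 / 2 * realZeta 3 : ℝ) : ℂ))) =
      ((-(realZeta 2 ^ 2 / (72 * realZeta 3)) : ℝ) : ℂ) by
        have : (realZeta 3 : ℂ) ≠ 0 := by exact_mod_cast hZ.ne'
        rw [mul_pow, Complex.I_sq]
        push_cast
        field_simp
        ring]
    rw [← Complex.ofReal_exp, ← Complex.ofReal_mul, ← Complex.ofReal_mul,
      show (1 / (2 * (π : ℂ))) = ((1 / (2 * π) : ℝ) : ℂ) by push_cast; rfl,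
      ← Complex.ofReal_mul, Complex.ofReal_re]
    ring
  · filter_upwards [ht] with n hn
    have hp : Complex.exp (-polarPart (t n)) =
        ((Real.exp (3 / 2 * realZeta 3 / t n ^ 2 + realZeta 2 / 2 / t n))⁻¹ : ℝ) := by
      rw [← Real.exp_neg, polarPart]
      push_cast
      rfl
    have hpi : (π : ℂ) ≠ 0 := by exact_mod_cast pi_ne_zero
    simp only [Function.comp]
    rw [hp, ← mul_assoc, one_div_mul_cancel (mul_ne_zero two_ne_zero hpi), one_mul,
      ← Complex.ofReal_natCast (qk _ _), ← Complex.ofReal_pow, ← Complex.ofReal_mul,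
      ← Complex.ofReal_div, ← Complex.ofReal_mul, Complex.ofReal_re, add_assoc,
      Real.exp_add (n * t n)]
    field_simp

lemma leadingConstant_eq {Z : ℝ} (hZ : 0 < Z) :
    (2 : ℝ) ^ (-(7 : ℝ) / 6) * (3 : ℝ) ^ (-(1 : ℝ) / 3) * π ^ (-(1 : ℝ) / 2) *
        Z ^ ((1 : ℝ) / 6) =
      (2 : ℝ) ^ (-(2 / 3) : ℝ) / (2 * π) * (π / (9 / 2 * Z)) ^ (1 / 2 : ℝ) *
        ((3 : ℝ) ^ ((1 : ℝ) / 3) * Z ^ ((1 : ℝ) / 3)) ^ 2 := by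
  have hpi := pi_pos
  refine Real.log_injOn_pos (Set.mem_Ioi.2 (by positivity)) (Set.mem_Ioi.2 (by positivity)) ?_
  have h9 : Real.log 9 = 2 * Real.log 3 := by
    rw [show (9 : ℝ) = 3 ^ 2 by norm_num, Real.log_pow]
    norm_num
  rw [Real.log_mul (by positivity) (by positivity), Real.log_mul (by positivity) (by positivity),
    Real.log_mul (by positivity) (by positivity), Real.log_mul (by positivity) (by positivity),
    Real.log_mul (by positivity) (by positivity), Real.log_div (by positivity) (by positivity),
    Real.log_mul (by positivity) (by positivity), Real.log_pow,
    Real.log_mul (by positivity) (by positivity), Real.log_rpow (by positivity),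
    Real.log_rpow (by positivity), Real.log_rpow (by positivity), Real.log_rpow (by positivity),
    Real.log_rpow (by positivity), Real.log_rpow (by positivity), Real.log_rpow (by positivity),
    Real.log_rpow (by positivity), Real.log_div (by positivity) (by positivity),
    Real.log_mul (by positivity) (by positivity), Real.log_div (by positivity) (by positivity), h9]
  push_cast
  ring

lemma rpow_one_third_pow_three {x : ℝ} (hx : 0 ≤ x) : (x ^ ((1 : ℝ) / 3)) ^ 3 = x := by
  rw [← Real.rpow_mul_natCast hx]
  norm_num

theorem stmt7 :
    Tendsto (fun n : ℕ => (qk (1 / 2) n : ℝ) /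
        ((2 : ℝ) ^ (-(7 : ℝ) / 6) * (3 : ℝ) ^ (-(1 : ℝ) / 3) * π ^ (-(1 : ℝ) / 2) *
          (realZeta 3) ^ ((1 : ℝ) / 6) * (n : ℝ) ^ (-(2 : ℝ) / 3) *
          Real.exp (((3 : ℝ) ^ ((4 : ℝ) / 3) * (realZeta 3) ^ ((1 : ℝ) / 3) / 2) *
              (n : ℝ) ^ ((2 : ℝ) / 3) +
            (realZeta 2 / (2 * (3 : ℝ) ^ ((1 : ℝ) / 3) * (realZeta 3) ^ ((1 : ℝ) / 3))) *
              (n : ℝ) ^ ((1 : ℝ) / 3) -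
            (realZeta 2) ^ 2 / (72 * realZeta 3))))
      atTop (𝓝 1) := by
  have hZ := realZeta_three_pos
  have ha3 := rpow_one_third_pow_three (x := 3) (by norm_num)
  have hb3 := rpow_one_third_pow_three hZ.le
  have h43 : (3 : ℝ) ^ ((4 : ℝ) / 3) = 3 * 3 ^ ((1 : ℝ) / 3) := by
    rw [show (4 : ℝ) / 3 = 1 + 1 / 3 by norm_num, Real.rpow_add (by norm_num), Real.rpow_one]
  have ha : 0 < (3 : ℝ) ^ ((1 : ℝ) / 3) := by positivity
  have hb : 0 < realZeta 3 ^ ((1 : ℝ) / 3) := by positivity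
  rw [leadingConstant_eq hZ, h43]
  set a := (3 : ℝ) ^ ((1 : ℝ) / 3)
  set b := realZeta 3 ^ ((1 : ℝ) / 3)
  have hm : Tendsto (fun n : ℕ => (n : ℝ) ^ ((1 : ℝ) / 3)) atTop atTop :=
    (tendsto_rpow_atTop (by norm_num)).comp tendsto_natCast_atTop_atTop
  have hpos : ∀ᶠ n : ℕ in atTop, 0 < (n : ℝ) ^ ((1 : ℝ) / 3) := hm.eventually_gt_atTop 0
  have h := tendsto_qk_one_half (t := fun n => a * b / (n : ℝ) ^ ((1 : ℝ) / 3))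
    (hpos.mono fun n hn => by positivity) (hm.const_div_atTop _)
    (hpos.mono fun n hn => by
      have hm3 := rpow_one_third_pow_three (Nat.cast_nonneg (α := ℝ) n)
      rw [div_pow, mul_pow, ha3, hb3, hm3, mul_div_cancel₀]
      rintro h0
      rw [h0] at hn
      norm_num at hn)
  have hL : 0 < (2 : ℝ) ^ (-(2 / 3) : ℝ) / (2 * π) * (π / (9 / 2 * realZeta 3)) ^ (1 / 2 : ℝ) *
      Real.exp (-(realZeta 2 ^ 2 / (72 * realZeta 3))) := by
    have := pi_pos
    positivity
  replace h := (h.div_const ((2 : ℝ) ^ (-(2 / 3) : ℝ) / (2 * π) *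
    (π / (9 / 2 * realZeta 3)) ^ (1 / 2 : ℝ) *
    Real.exp (-(realZeta 2 ^ 2 / (72 * realZeta 3)))))
  rw [div_self hL.ne'] at h
  refine h.congr' (hpos.mono fun n hn => ?_)
  have hm3 := rpow_one_third_pow_three (Nat.cast_nonneg (α := ℝ) n)
  have hm2 : (n : ℝ) ^ ((2 : ℝ) / 3) = ((n : ℝ) ^ ((1 : ℝ) / 3)) ^ 2 := by
    rw [← Real.rpow_mul_natCast (Nat.cast_nonneg n)]
    norm_num
  beta_reduce
  rw [neg_div, Real.rpow_neg (Nat.cast_nonneg n), hm2, div_div]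
  set m := (n : ℝ) ^ ((1 : ℝ) / 3)
  have he : (n : ℝ) * (a * b / m) + 3 / 2 * realZeta 3 / (a * b / m) ^ 2 +
      realZeta 2 / 2 / (a * b / m) = 3 * a * b / 2 * m ^ 2 + realZeta 2 / (2 * a * b) * m := by
    rw [← hm3, ← hb3]
    generalize hc : realZeta 2 = c
    have h3 : (3 : ℝ) / 2 = a ^ 3 / 2 := by rw [ha3]
    rw [h3]
    field_simp
    ring
  rw [he, sub_eq_add_neg, Real.exp_add _ (-_)]
  congr 1
  field_simp
end
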